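/- arXiv:1809.05417 — 15 statements merged into one kernel-verified Lean document; each statement's English description precedes it below -/
import Mathlib

section
/- Let X and Y be n×n real symmetric matrices and let λ↓(X), λ↓(Y) ∈ ℝⁿ denote their eigenvalue vectors (eigenvalues counted with multiplicity, arranged in decreasing order). Then tr(XY) ≤ ∑_{i=1}^{n} λ↓ᵢ(X) λ↓ᵢ(Y). -/
open Matrix

namespace Matrix

variable {n : Type*} [Fintype n] [DecidableEq n]

/-- The rearrangement inequality for doubly stochastic matrices. -/
theorem _root_.Monovary.dotProduct_mulVec_le_of_mem_doublyStochastic {f g : n → ℝ}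
    (hfg : Monovary f g) {D : Matrix n n ℝ} (hD : D ∈ doublyStochastic ℝ n) :
    f ⬝ᵥ D *ᵥ g ≤ f ⬝ᵥ g := by
  obtain ⟨w, hw, hw_sum, rfl⟩ := exists_eq_sum_perm_of_mem_doublyStochastic hD
  simp only [sum_mulVec, dotProduct_sum, smul_mulVec, dotProduct_smul, permMatrix_mulVec,
    smul_eq_mul]
  calc ∑ σ, w σ * (f ⬝ᵥ (g ∘ σ)) ≤ ∑ σ, w σ * (f ⬝ᵥ g) :=
        Finset.sum_le_sum fun σ _ ↦
          mul_le_mul_of_nonneg_left hfg.sum_mul_comp_perm_le_sum_mul (hw σ)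
    _ = f ⬝ᵥ g := by rw [← Finset.sum_mul, hw_sum, one_mul]

/-- The entrywise square of an orthogonal matrix is doubly stochastic. -/
theorem map_sq_mem_doublyStochastic {W : Matrix n n ℝ} (hW : W ∈ unitaryGroup n ℝ) :
    W.map (· ^ 2) ∈ doublyStochastic ℝ n := by
  refine mem_doublyStochastic_iff_sum.2 ⟨fun i j ↦ sq_nonneg _, fun i ↦ ?_, fun j ↦ ?_⟩
  · simpa [mul_apply, sq] using congr_fun₂ (mem_unitaryGroup_iff.1 hW) i i
  · simpa [mul_apply, sq] using congr_fun₂ (mem_unitaryGroup_iff'.1 hW) j j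

theorem trace_diagonal_mul_mul_diagonal_mul_star (a b : n → ℝ) (W : Matrix n n ℝ) :
    (diagonal a * W * diagonal b * star W).trace = a ⬝ᵥ W.map (· ^ 2) *ᵥ b := by
  simp only [trace, diag_apply, dotProduct, mulVec, map_apply, Finset.mul_sum]
  refine Finset.sum_congr rfl fun i _ ↦ ?_
  rw [mul_apply]
  simp only [mul_diagonal, diagonal_mul, star_apply, star_trivial]
  exact Finset.sum_congr rfl fun j _ ↦ by ring

theorem IsHermitian.exists_mem_doublyStochastic_trace_mul_eq {X Y : Matrix n n ℝ}
    (hX : X.IsHermitian) (hY : Y.IsHermitian) :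
    ∃ D ∈ doublyStochastic ℝ n, (X * Y).trace = hX.eigenvalues ⬝ᵥ D *ᵥ hY.eigenvalues := by
  let W := star hX.eigenvectorUnitary * hY.eigenvectorUnitary
  refine ⟨_, map_sq_mem_doublyStochastic W.2, ?_⟩
  rw [← trace_diagonal_mul_mul_diagonal_mul_star]
  conv_lhs => rw [hX.spectral_theorem, hY.spectral_theorem]
  simp only [Unitary.conjStarAlgAut_apply, W, Submonoid.coe_mul, Unitary.coe_star, star_mul,
    star_star, mul_assoc]
  rw [trace_mul_comm]
  simp only [mul_assoc]
  rfl

end Matrix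

/-- For real symmetric `X, Y`, with `μ = λ↓(X)` and `ν = λ↓(Y)` the
eigenvalue vectors arranged in decreasing order, `tr(XY) ≤ ∑ i, μ i * ν i`. -/
theorem trace_mul_le_inner_eigenvalues_sorted {n : ℕ}
    (X Y : Matrix (Fin n) (Fin n) ℝ) (hX : X.IsHermitian) (hY : Y.IsHermitian)
    (μ ν : Fin n → ℝ) (hμa : Antitone μ) (hνa : Antitone ν)
    (hμ : ∃ σ : Equiv.Perm (Fin n), μ = hX.eigenvalues ∘ σ)
    (hν : ∃ σ : Equiv.Perm (Fin n), ν = hY.eigenvalues ∘ σ) :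
    (X * Y).trace ≤ ∑ i, μ i * ν i := by
  obtain ⟨D, hD, h_trace⟩ := hX.exists_mem_doublyStochastic_trace_mul_eq hY
  obtain ⟨σ, rfl⟩ := hμ
  obtain ⟨τ, rfl⟩ := hν
  have h_reindex : (hX.eigenvalues ∘ σ) ⬝ᵥ D.submatrix σ τ *ᵥ (hY.eigenvalues ∘ τ) =
      hX.eigenvalues ⬝ᵥ D *ᵥ hY.eigenvalues := by
    rw [submatrix_mulVec_equiv, Function.comp_assoc, Equiv.self_comp_symm, Function.comp_id,
      comp_equiv_dotProduct_comp_equiv]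
  rw [h_trace, ← h_reindex]
  exact (hμa.monovary hνa).dotProduct_mulVec_le_of_mem_doublyStochastic
    (reindex_mem_doublyStochastic (e₁ := σ.symm) (e₂ := τ.symm) hD)
end

section
/- Let X and Y be n×n real symmetric matrices. Then tr(XY) = ∑_{i=1}^{n} λ↓ᵢ(X) λ↓ᵢ(Y) holds if and only if X and Y strongly operator commute, i.e., there exists an orthogonal matrix U such that X = U · diag(λ↓₁(X),…,λ↓ₙ(X)) · Uᵀ and Y = U · diag(λ↓₁(Y),…,λ↓ₙ(Y)) · Uᵀ. -/
open Matrix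

namespace Matrix

section General

variable {m : Type*} [Fintype m]

theorem eq_of_trace_mul_eq {A B : Matrix m m ℝ} {c : ℝ} (hA : Aᵀ = A) (hB : Bᵀ = B)
    (hAA : (A * A).trace = c) (hBB : (B * B).trace = c) (hAB : (A * B).trace = c) : A = B := by
  rw [← sub_eq_zero, ← trace_conjTranspose_mul_self_eq_zero_iff,
    conjTranspose_eq_transpose_of_trivial, transpose_sub, hA, hB, Matrix.mul_sub, Matrix.sub_mul,
    Matrix.sub_mul, trace_sub, trace_sub, trace_sub, trace_mul_comm B A, hAA, hBB, hAB]
  ring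

variable [DecidableEq m]

theorem sq_entries_mem_doublyStochastic {W : Matrix m m ℝ} (hW : Wᵀ * W = 1) :
    (of fun i j => W i j ^ 2) ∈ doublyStochastic ℝ m := by
  have hW' : W * Wᵀ = 1 := mul_eq_one_comm.mp hW
  refine mem_doublyStochastic_iff_sum.2 ⟨fun i j => sq_nonneg _, fun i => ?_, fun j => ?_⟩
  · have h := congrFun (congrFun hW' i) i
    simpa [mul_apply, pow_two] using h
  · have h := congrFun (congrFun hW j) j
    simpa [mul_apply, pow_two] using h

theorem sum_mul_le_of_mem_doublyStochastic {S : Matrix m m ℝ} (hS : S ∈ doublyStochastic ℝ m)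
    {a b : m → ℝ} (hab : Monovary a b) :
    ∑ i, ∑ j, a i * S i j * b j ≤ ∑ i, a i * b i := by
  obtain ⟨w, hw, hw1, rfl⟩ := exists_eq_sum_perm_of_mem_doublyStochastic hS
  calc ∑ i, ∑ j, a i * (∑ σ, w σ • Equiv.Perm.permMatrix ℝ σ) i j * b j
      = ∑ σ : Equiv.Perm m, w σ * ∑ i, a i * b (σ i) := by
        simp only [Matrix.sum_apply, Matrix.smul_apply, smul_eq_mul, Finset.mul_sum,
          Finset.sum_mul]
        simp_rw [Finset.sum_comm (t := (Finset.univ : Finset (Equiv.Perm m)))]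
        refine Finset.sum_congr rfl fun σ _ => ?_
        refine Finset.sum_congr rfl fun i _ => ?_
        rw [Finset.sum_eq_single (σ i)]
        · simp [PEquiv.toMatrix_apply, Equiv.toPEquiv_apply]
          ring
        · intro j _ hj
          simp [PEquiv.toMatrix_apply, Equiv.toPEquiv_apply, hj.symm]
        · simp
    _ ≤ ∑ σ : Equiv.Perm m, w σ * ∑ i, a i * b i :=
        Finset.sum_le_sum fun σ _ =>
          mul_le_mul_of_nonneg_left hab.sum_mul_comp_perm_le_sum_mul (hw σ)
    _ = ∑ i, a i * b i := by rw [← Finset.sum_mul, hw1, one_mul]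

/-- Von Neumann's trace inequality for real symmetric matrices given in diagonalized form. -/
theorem trace_conj_diagonal_mul_le {P Q : Matrix m m ℝ} (hP : Pᵀ * P = 1) (hQ : Qᵀ * Q = 1)
    {a b : m → ℝ} (hab : Monovary a b) :
    ((P * diagonal a * Pᵀ) * (Q * diagonal b * Qᵀ)).trace ≤ ∑ i, a i * b i := by
  have hW : (Pᵀ * Q)ᵀ * (Pᵀ * Q) = 1 := by
    have hP' : P * Pᵀ = 1 := mul_eq_one_comm.mp hP
    rw [transpose_mul, transpose_transpose, Matrix.mul_assoc, ← Matrix.mul_assoc P, hP',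
      Matrix.one_mul, hQ]
  refine le_of_eq_of_le ?_
    (sum_mul_le_of_mem_doublyStochastic (sq_entries_mem_doublyStochastic hW) hab)
  have h : ((P * diagonal a * Pᵀ) * (Q * diagonal b * Qᵀ)).trace =
      ((diagonal a * (Pᵀ * Q) * diagonal b) * (Pᵀ * Q)ᵀ).trace := by
    rw [transpose_mul, transpose_transpose]
    simp only [Matrix.mul_assoc]
    rw [trace_mul_comm]
    simp only [Matrix.mul_assoc]
  rw [h]
  simp only [trace, diag_apply, mul_apply (N := (Pᵀ * Q)ᵀ), mul_diagonal, diagonal_mul,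
    transpose_apply, of_apply]
  exact Finset.sum_congr rfl fun i _ => Finset.sum_congr rfl fun j _ => by ring

theorem trace_conj_diagonal_mul_conj_diagonal {P : Matrix m m ℝ} (hP : Pᵀ * P = 1)
    (a b : m → ℝ) :
    ((P * diagonal a * Pᵀ) * (P * diagonal b * Pᵀ)).trace = ∑ i, a i * b i := by
  have h : (P * diagonal a * Pᵀ) * (P * diagonal b * Pᵀ) =
      P * (diagonal a * diagonal b * Pᵀ) := by
    simp only [Matrix.mul_assoc]
    rw [← Matrix.mul_assoc Pᵀ, hP, Matrix.one_mul]
  rw [h, trace_mul_comm, Matrix.mul_assoc, hP, Matrix.mul_one, diagonal_mul_diagonal,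
    trace_diagonal]

theorem IsHermitian.exists_eq_conj_diagonal_comp_perm {A : Matrix m m ℝ} (hA : A.IsHermitian)
    (σ : Equiv.Perm m) :
    ∃ P : Matrix m m ℝ, Pᵀ * P = 1 ∧ A = P * diagonal (hA.eigenvalues ∘ σ) * Pᵀ := by
  let V : Matrix m m ℝ := (hA.eigenvectorUnitary : Matrix m m ℝ)
  have hVV : Vᵀ * V = 1 := by
    have := Unitary.coe_star_mul_self hA.eigenvectorUnitary
    rwa [star_eq_conjTranspose, conjTranspose_eq_transpose_of_trivial] at this
  have hspec : A = V * diagonal hA.eigenvalues * Vᵀ := by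
    have := hA.spectral_theorem
    rwa [Unitary.conjStarAlgAut_apply, star_eq_conjTranspose,
      conjTranspose_eq_transpose_of_trivial] at this
  refine ⟨V.submatrix id σ, ?_, ?_⟩
  · rw [transpose_submatrix, submatrix_mul _ _ _ id _ Function.bijective_id |>.symm, hVV,
      submatrix_one_equiv]
  · rw [transpose_submatrix, ← submatrix_diagonal_equiv,
      ← submatrix_mul _ _ _ σ _ σ.bijective, ← submatrix_mul _ _ _ σ _ σ.bijective,
      submatrix_id_id, ← hspec]

theorem transpose_conj_diagonal (P : Matrix m m ℝ) (a : m → ℝ) :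
    (P * diagonal a * Pᵀ)ᵀ = P * diagonal a * Pᵀ := by
  simp [Matrix.mul_assoc]

end General

theorem IsHermitian.exists_eq_conj_diagonal_antitone {n : ℕ} {A : Matrix (Fin n) (Fin n) ℝ}
    (hA : A.IsHermitian) :
    ∃ (P : Matrix (Fin n) (Fin n) ℝ) (c : Fin n → ℝ),
      Pᵀ * P = 1 ∧ Antitone c ∧ A = P * diagonal c * Pᵀ := by
  obtain ⟨P, hP, h⟩ := hA.exists_eq_conj_diagonal_comp_perm
    (Tuple.sort fun i => -hA.eigenvalues i)
  refine ⟨P, _, hP, fun i j hij => ?_, h⟩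
  exact neg_le_neg_iff.mp (Tuple.monotone_sort (fun i => -hA.eigenvalues i) hij)

end Matrix

/-- For real symmetric `X, Y`, with `μ = λ↓(X)` and `ν = λ↓(Y)` the eigenvalue
vectors arranged in decreasing order, `tr(XY) = ∑ i, μ i * ν i` if and only if `X` and `Y`
strongly operator commute: there is an orthogonal `U` with `X = U diag(μ) Uᵀ` and
`Y = U diag(ν) Uᵀ`. -/
theorem trace_mul_eq_inner_eigenvalues_sorted_iff {n : ℕ}
    (X Y : Matrix (Fin n) (Fin n) ℝ) (hX : X.IsHermitian) (hY : Y.IsHermitian)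
    (μ ν : Fin n → ℝ) (hμa : Antitone μ) (hνa : Antitone ν)
    (hμ : ∃ σ : Equiv.Perm (Fin n), μ = hX.eigenvalues ∘ σ)
    (hν : ∃ σ : Equiv.Perm (Fin n), ν = hY.eigenvalues ∘ σ) :
    (X * Y).trace = ∑ i, μ i * ν i ↔
      ∃ U : Matrix (Fin n) (Fin n) ℝ, Uᵀ * U = 1 ∧
        X = U * Matrix.diagonal μ * Uᵀ ∧ Y = U * Matrix.diagonal ν * Uᵀ := by
  obtain ⟨σ, hσ⟩ := hμ
  obtain ⟨τ, hτ⟩ := hν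
  obtain ⟨P, hP, hXP⟩ := hX.exists_eq_conj_diagonal_comp_perm σ
  obtain ⟨Q, hQ, hYQ⟩ := hY.exists_eq_conj_diagonal_comp_perm τ
  rw [← hσ] at hXP
  rw [← hτ] at hYQ
  constructor
  · intro hXY
    obtain ⟨U, γ, hU, hγ, hA⟩ := (hX.add hY).exists_eq_conj_diagonal_antitone
    have hXX : (X * X).trace = ∑ i, μ i * μ i := by
      rw [hXP, trace_conj_diagonal_mul_conj_diagonal hP]
    have hYY : (Y * Y).trace = ∑ i, ν i * ν i := by
      rw [hYQ, trace_conj_diagonal_mul_conj_diagonal hQ]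
    have hXle : ∀ {b : Fin n → ℝ}, Antitone b →
        (X * (U * diagonal b * Uᵀ)).trace ≤ ∑ i, μ i * b i := fun hb => by
      rw [hXP]
      exact trace_conj_diagonal_mul_le hP hU (hμa.monovary hb)
    have hYle : ∀ {b : Fin n → ℝ}, Antitone b →
        (Y * (U * diagonal b * Uᵀ)).trace ≤ ∑ i, ν i * b i := fun hb => by
      rw [hYQ]
      exact trace_conj_diagonal_mul_le hQ hU (hνa.monovary hb)
    have hγγ : ((X + Y) * (X + Y)).trace = ∑ i, γ i * γ i := by
      rw [hA, trace_conj_diagonal_mul_conj_diagonal hU]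
    have hexp : ((X + Y) * (X + Y)).trace =
        ∑ i, μ i * μ i + 2 * ∑ i, μ i * ν i + ∑ i, ν i * ν i := by
      simp only [Matrix.add_mul, Matrix.mul_add, trace_add, trace_mul_comm Y X, hXX, hXY, hYY]
      ring
    have hγeq : γ = μ + ν := by
      have h1 := hXle hγ
      have h2 := hYle hγ
      have h3 : (X * (U * diagonal γ * Uᵀ)).trace + (Y * (U * diagonal γ * Uᵀ)).trace =
          ((X + Y) * (X + Y)).trace := by
        rw [← hA, ← trace_add, ← Matrix.add_mul]
      have h4 : ∑ i, (μ i + ν i - γ i) ^ 2 =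
          (∑ i, μ i * μ i + 2 * ∑ i, μ i * ν i + ∑ i, ν i * ν i) + ∑ i, γ i * γ i -
            2 * (∑ i, μ i * γ i + ∑ i, ν i * γ i) := by
        simp only [Finset.mul_sum, ← Finset.sum_add_distrib, ← Finset.sum_sub_distrib]
        exact Finset.sum_congr rfl fun i _ => by ring
      have h5 : ∑ i, (μ i + ν i - γ i) ^ 2 = 0 :=
        le_antisymm (by linarith) (Finset.sum_nonneg fun i _ => sq_nonneg _)
      funext i
      have h6 := (Finset.sum_eq_zero_iff_of_nonneg fun i _ => sq_nonneg _).1 h5 i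
        (Finset.mem_univ i)
      have h7 := pow_eq_zero_iff two_ne_zero |>.1 h6
      simp only [Pi.add_apply]
      linarith
    have hsplit : X + Y = U * diagonal μ * Uᵀ + U * diagonal ν * Uᵀ := by
      rw [hA, hγeq, ← Matrix.add_mul, ← Matrix.mul_add, diagonal_add]
      rfl
    have htr : (X * (U * diagonal μ * Uᵀ)).trace + (X * (U * diagonal ν * Uᵀ)).trace =
        ∑ i, μ i * μ i + ∑ i, μ i * ν i := by
      rw [← trace_add, ← Matrix.mul_add, ← hsplit, Matrix.mul_add, trace_add, hXX, hXY]
    have hXeq : X = U * diagonal μ * Uᵀ :=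
      eq_of_trace_mul_eq hX.eq (transpose_conj_diagonal U μ) hXX
        (trace_conj_diagonal_mul_conj_diagonal hU μ μ)
        (le_antisymm (hXle hμa) (by linarith [hXle hνa]))
    refine ⟨U, hU, hXeq, ?_⟩
    rw [← hXeq] at hsplit
    exact add_left_cancel hsplit
  · rintro ⟨U, hU, hXU, hYU⟩
    rw [hXU, hYU, trace_conj_diagonal_mul_conj_diagonal hU]
end

section
/- Let X and Y be n×n real symmetric matrices, and let p, q ∈ (1, ∞) be real numbers with 1/p + 1/q = 1. Then ‖X∘Y‖₁ ≤ ‖X‖ₚ · ‖Y‖_q, i.e., the sum of the absolute values of the eigenvalues of (XY + YX)/2 is at most ‖X‖ₚ · ‖Y‖_q. -/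
open Matrix

/-- The spectral `p`-norm of a symmetric/Hermitian matrix:
`‖X‖ₚ = (∑ i, |λᵢ(X)|^p)^(1/p)`. -/
noncomputable def spectralPNorm {n : ℕ} (p : ℝ) {X : Matrix (Fin n) (Fin n) ℝ}
    (hX : X.IsHermitian) : ℝ :=
  (∑ i, |hX.eigenvalues i| ^ p) ^ (1 / p)

theorem Matrix.IsHermitian.exists_orthogonal_diagonalization {n : ℕ}
    {X : Matrix (Fin n) (Fin n) ℝ} (hX : X.IsHermitian) :
    ∃ U : Matrix (Fin n) (Fin n) ℝ, Uᵀ * U = 1 ∧ U * Uᵀ = 1 ∧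
      X = U * diagonal hX.eigenvalues * Uᵀ := by
  refine ⟨hX.eigenvectorUnitary, ?_, ?_, ?_⟩
  · simpa [star_eq_conjTranspose] using Unitary.coe_star_mul_self hX.eigenvectorUnitary
  · simpa [star_eq_conjTranspose] using Unitary.coe_mul_star_self hX.eigenvectorUnitary
  · have h := hX.spectral_theorem
    rw [Unitary.conjStarAlgAut_apply] at h
    simpa [star_eq_conjTranspose, Function.comp_def] using h

theorem sum_sq_row_eq_one {n : ℕ} {A : Matrix (Fin n) (Fin n) ℝ} (hA : A * Aᵀ = 1)
    (i : Fin n) : ∑ j, A i j ^ 2 = 1 := by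
  have h := congrFun (congrFun hA i) i
  simpa [mul_apply, sq] using h

theorem sum_sq_col_eq_one {n : ℕ} {A : Matrix (Fin n) (Fin n) ℝ} (hA : A * Aᵀ = 1)
    (j : Fin n) : ∑ i, A i j ^ 2 = 1 :=
  sum_sq_row_eq_one (A := Aᵀ) (by rw [transpose_transpose]; exact mul_eq_one_comm.mp hA) j

/-- Hölder's inequality weighted by a doubly stochastic matrix. -/
theorem sum_mul_mul_le_of_doublyStochastic {n : ℕ} {M : Fin n → Fin n → ℝ}
    (hM : ∀ i j, 0 ≤ M i j) (hrow : ∀ i, ∑ j, M i j = 1) (hcol : ∀ j, ∑ i, M i j = 1)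
    {p q : ℝ} (hpq : p.HolderConjugate q) {a b : Fin n → ℝ}
    (ha : ∀ i, 0 ≤ a i) (hb : ∀ i, 0 ≤ b i) :
    ∑ i, ∑ j, M i j * (a i * b j) ≤ (∑ i, a i ^ p) ^ (1 / p) * (∑ j, b j ^ q) ^ (1 / q) := by
  have key := Real.inner_le_Lp_mul_Lq_of_nonneg (Finset.univ : Finset (Fin n × Fin n)) hpq
    (f := fun x => M x.1 x.2 ^ (1 / p) * a x.1) (g := fun x => M x.1 x.2 ^ (1 / q) * b x.2)
    (fun x _ => mul_nonneg (Real.rpow_nonneg (hM _ _) _) (ha _))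
    (fun x _ => mul_nonneg (Real.rpow_nonneg (hM _ _) _) (hb _))
  have hf (i j : Fin n) : (M i j ^ (1 / p) * a i) ^ p = M i j * a i ^ p := by
    rw [Real.mul_rpow (Real.rpow_nonneg (hM _ _) _) (ha _), ← Real.rpow_mul (hM _ _),
      one_div_mul_cancel hpq.ne_zero, Real.rpow_one]
  have hg (i j : Fin n) : (M i j ^ (1 / q) * b j) ^ q = M i j * b j ^ q := by
    rw [Real.mul_rpow (Real.rpow_nonneg (hM _ _) _) (hb _), ← Real.rpow_mul (hM _ _),
      one_div_mul_cancel hpq.symm.ne_zero, Real.rpow_one]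
  have hfg (i j : Fin n) :
      M i j ^ (1 / p) * a i * (M i j ^ (1 / q) * b j) = M i j * (a i * b j) := by
    have h : M i j ^ (1 / p) * M i j ^ (1 / q) = M i j := by
      have hs : 1 / p + 1 / q = 1 := by simpa using hpq.inv_add_inv_eq_one
      rw [← Real.rpow_add' (hM _ _) (by rw [hs]; exact one_ne_zero), hs, Real.rpow_one]
    rw [mul_mul_mul_comm, h]
  simp only [Fintype.sum_prod_type, hf, hg, hfg] at key
  rw [Finset.sum_comm (f := fun i j => M i j * b j ^ q)] at key
  simpa only [← Finset.sum_mul, hrow, hcol, one_mul] using key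

theorem trace_diagonal_mul_orthogonal_le {n : ℕ} {A B : Matrix (Fin n) (Fin n) ℝ}
    (hA : A * Aᵀ = 1) (hB : B * Bᵀ = 1) {p q : ℝ} (hpq : p.HolderConjugate q)
    (d e : Fin n → ℝ) :
    trace (diagonal d * A * (diagonal e * B)) ≤
      (∑ i, |d i| ^ p) ^ (1 / p) * (∑ j, |e j| ^ q) ^ (1 / q) := by
  refine le_trans ?_ (sum_mul_mul_le_of_doublyStochastic
    (M := fun i j => (A i j ^ 2 + B j i ^ 2) / 2) (fun i j => by positivity) (fun i => ?_)
    (fun j => ?_) hpq (fun i => abs_nonneg (d i)) (fun j => abs_nonneg (e j)))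
  · simp only [trace, diag_apply, mul_apply (M := diagonal d * A), diagonal_mul]
    refine Finset.sum_le_sum fun i _ => Finset.sum_le_sum fun j _ => ?_
    calc d i * A i j * (e j * B j i) ≤ |d i * A i j * (e j * B j i)| := le_abs_self _
      _ = |A i j| * |B j i| * (|d i| * |e j|) := by simp only [abs_mul]; ring
      _ ≤ (A i j ^ 2 + B j i ^ 2) / 2 * (|d i| * |e j|) := by
        gcongr
        nlinarith [sq_nonneg (|A i j| - |B j i|), sq_abs (A i j), sq_abs (B j i)]
  · rw [← Finset.sum_div, Finset.sum_add_distrib, sum_sq_row_eq_one hA, sum_sq_col_eq_one hB]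
    norm_num
  · rw [← Finset.sum_div, Finset.sum_add_distrib, sum_sq_col_eq_one hA, sum_sq_row_eq_one hB]
    norm_num

theorem trace_mul_mul_orthogonal_le {n : ℕ} {X Y S : Matrix (Fin n) (Fin n) ℝ}
    (hX : X.IsHermitian) (hY : Y.IsHermitian) (hS : S * Sᵀ = 1)
    {p q : ℝ} (hpq : p.HolderConjugate q) :
    trace (X * Y * S) ≤ spectralPNorm p hX * spectralPNorm q hY := by
  obtain ⟨U, hU, hU', hXU⟩ := hX.exists_orthogonal_diagonalization
  obtain ⟨V, hV, hV', hYV⟩ := hY.exists_orthogonal_diagonalization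
  have hA : (Uᵀ * V) * (Uᵀ * V)ᵀ = 1 := by
    rw [transpose_mul, transpose_transpose, Matrix.mul_assoc, ← Matrix.mul_assoc V, hV',
      Matrix.one_mul, hU]
  have hB : (Vᵀ * S * U) * (Vᵀ * S * U)ᵀ = 1 := by
    rw [transpose_mul, transpose_mul, transpose_transpose, Matrix.mul_assoc,
      ← Matrix.mul_assoc U, hU', Matrix.one_mul, Matrix.mul_assoc, ← Matrix.mul_assoc S, hS,
      Matrix.one_mul, hV]
  have h := trace_diagonal_mul_orthogonal_le hA hB hpq hX.eigenvalues hY.eigenvalues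
  have htr : trace (X * Y * S) = trace (diagonal hX.eigenvalues * (Uᵀ * V) *
      (diagonal hY.eigenvalues * (Vᵀ * S * U))) := by
    conv_lhs => rw [hXU, hYV]
    simp only [Matrix.mul_assoc]
    rw [trace_mul_comm]
    simp only [Matrix.mul_assoc]
  rw [htr]
  exact h

/-- The sum of the absolute values of the eigenvalues is attained by pairing with the
symmetric orthogonal matrix given by the signs of the eigenvalues. -/
theorem Matrix.IsHermitian.exists_trace_mul_eq_sum_abs_eigenvalues {n : ℕ}
    {J : Matrix (Fin n) (Fin n) ℝ} (hJ : J.IsHermitian) :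
    ∃ S : Matrix (Fin n) (Fin n) ℝ, Sᵀ = S ∧ S * Sᵀ = 1 ∧
      trace (J * S) = ∑ i, |hJ.eigenvalues i| := by
  obtain ⟨W, hW, hW', hJW⟩ := hJ.exists_orthogonal_diagonalization
  set s : Fin n → ℝ := fun i => if 0 ≤ hJ.eigenvalues i then 1 else -1 with hs
  have hss : diagonal s * diagonal s = (1 : Matrix (Fin n) (Fin n) ℝ) := by
    rw [diagonal_mul_diagonal, ← diagonal_one]
    congr 1
    funext i
    simp only [hs]
    split_ifs <;> norm_num
  have hsymm : (W * diagonal s * Wᵀ)ᵀ = W * diagonal s * Wᵀ := by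
    simp [transpose_mul, Matrix.mul_assoc]
  have hmul (d e : Fin n → ℝ) : (W * diagonal d * Wᵀ) * (W * diagonal e * Wᵀ) =
      W * (diagonal d * diagonal e) * Wᵀ := by
    calc _ = W * diagonal d * (Wᵀ * W) * diagonal e * Wᵀ := by simp only [Matrix.mul_assoc]
      _ = _ := by rw [hW, Matrix.mul_one, Matrix.mul_assoc W]
  refine ⟨W * diagonal s * Wᵀ, hsymm, ?_, ?_⟩
  · rw [hsymm, hmul, hss, Matrix.mul_one, hW']
  · conv_lhs => rw [hJW]
    rw [hmul, trace_mul_comm, ← Matrix.mul_assoc, hW, Matrix.one_mul, diagonal_mul_diagonal,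
      trace_diagonal]
    refine Finset.sum_congr rfl fun i _ => ?_
    simp only [hs]
    split_ifs with h
    · rw [mul_one, abs_of_nonneg h]
    · rw [abs_of_neg (not_le.mp h), mul_neg_one]

/-- For real symmetric `X, Y` and conjugate exponents `p, q ∈ (1, ∞)`,
`‖X∘Y‖₁ ≤ ‖X‖ₚ ‖Y‖_q`, where `X∘Y = (XY + YX)/2` is the Jordan product. -/
theorem spectralPNorm_one_jordan_le {n : ℕ}
    (X Y : Matrix (Fin n) (Fin n) ℝ) (hX : X.IsHermitian) (hY : Y.IsHermitian)
    (hJ : ((1 / 2 : ℝ) • (X * Y + Y * X)).IsHermitian)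
    (p q : ℝ) (hp : 1 < p) (hq : 1 < q) (hpq : 1 / p + 1 / q = 1) :
    spectralPNorm 1 hJ ≤ spectralPNorm p hX * spectralPNorm q hY := by
  have hpq' : p.HolderConjugate q :=
    Real.holderConjugate_iff.mpr ⟨hp, by simpa using hpq⟩
  obtain ⟨S, hSsymm, hS, htr⟩ := hJ.exists_trace_mul_eq_sum_abs_eigenvalues
  have hswap : trace (Y * X * S) = trace (X * Y * S) := by
    have hXt : Xᵀ = X := by simpa [IsSymm] using hX
    have hYt : Yᵀ = Y := by simpa [IsSymm] using hY
    rw [← trace_transpose, transpose_mul, transpose_mul, hSsymm, hXt, hYt, trace_mul_comm]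
  have hJS : trace (((1 / 2 : ℝ) • (X * Y + Y * X)) * S) = trace (X * Y * S) := by
    rw [smul_mul_assoc, trace_smul, Matrix.add_mul, trace_add, hswap, smul_eq_mul]
    ring
  have hone : spectralPNorm 1 hJ = ∑ i, |hJ.eigenvalues i| := by
    simp [spectralPNorm]
  rw [hone, ← htr, hJS]
  exact trace_mul_mul_orthogonal_le hX hY hS hpq'
end

section
/- Let X and Y be n×n complex Hermitian matrices, and let p, q ∈ (1, ∞) be real numbers with 1/p + 1/q = 1. Then ‖X∘Y‖₁ ≤ ‖X‖ₚ · ‖Y‖_q, i.e., the sum of the absolute values of the eigenvalues of (XY + YX)/2 is at most ‖X‖ₚ · ‖Y‖_q. -/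
open Matrix

/-- The spectral `p`-norm of a complex Hermitian matrix:
`‖X‖ₚ = (∑ i, |λᵢ(X)|^p)^(1/p)` (the eigenvalues of a Hermitian matrix are real). -/
noncomputable def spectralPNormC {n : ℕ} (p : ℝ) {X : Matrix (Fin n) (Fin n) ℂ}
    (hX : X.IsHermitian) : ℝ :=
  (∑ i, |hX.eigenvalues i| ^ p) ^ (1 / p)

/-- Hölder's inequality weighted by a matrix whose rows and columns have sums at most `1`. -/
theorem sum_mul_mul_le_of_doubly_substochastic {ι κ : Type*} [Fintype ι] [Fintype κ]
    {p q : ℝ} (hpq : p.HolderConjugate q) (M : ι → κ → ℝ) (hM : ∀ i j, 0 ≤ M i j)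
    (hrow : ∀ i, ∑ j, M i j ≤ 1) (hcol : ∀ j, ∑ i, M i j ≤ 1)
    (a : ι → ℝ) (b : κ → ℝ) (ha : ∀ i, 0 ≤ a i) (hb : ∀ j, 0 ≤ b j) :
    ∑ i, ∑ j, a i * b j * M i j ≤ (∑ i, a i ^ p) ^ (1 / p) * (∑ j, b j ^ q) ^ (1 / q) := by
  have hp := hpq.pos
  have hq := hpq.symm.pos
  have key := Real.inner_le_Lp_mul_Lq_of_nonneg (Finset.univ : Finset (ι × κ)) hpq
    (f := fun x => a x.1 * M x.1 x.2 ^ (1 / p)) (g := fun x => b x.2 * M x.1 x.2 ^ (1 / q))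
    (fun x _ => mul_nonneg (ha _) (Real.rpow_nonneg (hM _ _) _))
    (fun x _ => mul_nonneg (hb _) (Real.rpow_nonneg (hM _ _) _))
  have root : ∀ r : ℝ, 0 < r → ∀ c m : ℝ, 0 ≤ c → 0 ≤ m →
      (c * m ^ (1 / r)) ^ r = c ^ r * m := by
    intro r hr c m hc hm
    rw [Real.mul_rpow hc (Real.rpow_nonneg hm _), ← Real.rpow_mul hm, one_div,
      inv_mul_cancel₀ hr.ne', Real.rpow_one]
  have hprod : ∀ i j, a i * M i j ^ (1 / p) * (b j * M i j ^ (1 / q)) = a i * b j * M i j := by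
    intro i j
    have h : M i j ^ (1 / p) * M i j ^ (1 / q) = M i j := by
      rw [← Real.rpow_add_of_nonneg (hM i j) (by positivity) (by positivity), one_div, one_div,
        hpq.inv_add_inv_eq_one, Real.rpow_one]
    linear_combination a i * b j * h
  simp only [Fintype.sum_prod_type, hprod, root p hp _ _ (ha _) (hM _ _),
    root q hq _ _ (hb _) (hM _ _)] at key
  refine key.trans ?_
  have hA : ∑ i, ∑ j, a i ^ p * M i j ≤ ∑ i, a i ^ p := by
    refine Finset.sum_le_sum fun i _ => ?_
    rw [← Finset.mul_sum]
    exact mul_le_of_le_one_right (Real.rpow_nonneg (ha i) _) (hrow i)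
  have hB : ∑ i, ∑ j, b j ^ q * M i j ≤ ∑ j, b j ^ q := by
    rw [Finset.sum_comm]
    refine Finset.sum_le_sum fun j _ => ?_
    rw [← Finset.mul_sum]
    exact mul_le_of_le_one_right (Real.rpow_nonneg (hb j) _) (hcol j)
  have hA0 : 0 ≤ ∑ i, ∑ j, a i ^ p * M i j := Finset.sum_nonneg fun i _ =>
    Finset.sum_nonneg fun j _ => mul_nonneg (Real.rpow_nonneg (ha i) _) (hM i j)
  have hB0 : 0 ≤ ∑ i, ∑ j, b j ^ q * M i j := Finset.sum_nonneg fun i _ =>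
    Finset.sum_nonneg fun j _ => mul_nonneg (Real.rpow_nonneg (hb j) _) (hM i j)
  have hA1 : 0 ≤ ∑ i, a i ^ p := hA0.trans hA
  gcongr

theorem Matrix.sum_norm_sq_row_of_mem_unitaryGroup {n : Type*} [Fintype n] [DecidableEq n]
    {U : Matrix n n ℂ} (hU : U ∈ unitaryGroup n ℂ) (i : n) : ∑ j, ‖U i j‖ ^ 2 = 1 := by
  have h := congrFun (congrFun (mem_unitaryGroup_iff.mp hU) i) i
  simp only [mul_apply, star_apply, one_apply_eq, RCLike.star_def, Complex.mul_conj'] at h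
  exact_mod_cast h

theorem Matrix.sum_norm_sq_col_of_mem_unitaryGroup {n : Type*} [Fintype n] [DecidableEq n]
    {U : Matrix n n ℂ} (hU : U ∈ unitaryGroup n ℂ) (j : n) : ∑ i, ‖U i j‖ ^ 2 = 1 := by
  have h := congrFun (congrFun (mem_unitaryGroup_iff'.mp hU) j) j
  simp only [mul_apply, star_apply, one_apply_eq, RCLike.star_def, Complex.conj_mul'] at h
  exact_mod_cast h

/-- Hölder's inequality for `tr (S X Y)` with `S` unitary and `X`, `Y` Hermitian. -/
theorem norm_trace_unitary_mul_mul_le {n : ℕ} {S X Y : Matrix (Fin n) (Fin n) ℂ}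
    (hS : S ∈ unitaryGroup (Fin n) ℂ) (hX : X.IsHermitian) (hY : Y.IsHermitian)
    {p q : ℝ} (hpq : p.HolderConjugate q) :
    ‖(S * (X * Y)).trace‖ ≤ spectralPNormC p hX * spectralPNormC q hY := by
  set U : Matrix (Fin n) (Fin n) ℂ := ↑hX.eigenvectorUnitary
  set V : Matrix (Fin n) (Fin n) ℂ := ↑hY.eigenvectorUnitary
  have hUm : U ∈ unitaryGroup (Fin n) ℂ := hX.eigenvectorUnitary.2
  have hVm : V ∈ unitaryGroup (Fin n) ℂ := hY.eigenvectorUnitary.2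
  have eX : X = U * diagonal (fun i => (hX.eigenvalues i : ℂ)) * star U := by
    conv_lhs => rw [hX.spectral_theorem, Unitary.conjStarAlgAut_apply]
    rfl
  have eY : Y = V * diagonal (fun i => (hY.eigenvalues i : ℂ)) * star V := by
    conv_lhs => rw [hY.spectral_theorem, Unitary.conjStarAlgAut_apply]
    rfl
  set P := star U * V with hP
  set Q := star V * S * U with hQ
  have hPm : P ∈ unitaryGroup (Fin n) ℂ := mul_mem (Unitary.star_mem hUm) hVm
  have hQm : Q ∈ unitaryGroup (Fin n) ℂ := mul_mem (mul_mem (Unitary.star_mem hVm) hS) hUm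
  have htr : (S * (X * Y)).trace =
      ∑ i, ∑ j, (hX.eigenvalues i : ℂ) * hY.eigenvalues j * (P i j * Q j i) := by
    have h : (S * (X * Y)).trace =
        ((diagonal (fun i => (hX.eigenvalues i : ℂ)) * P) *
          (diagonal (fun i => (hY.eigenvalues i : ℂ)) * Q)).trace := by
      conv_lhs => rw [eX, eY]
      rw [hP, hQ]
      simp only [Matrix.mul_assoc]
      rw [← Matrix.mul_assoc S U, Matrix.trace_mul_comm]
      simp only [Matrix.mul_assoc]
    rw [h]
    refine Finset.sum_congr rfl fun i _ => ?_
    rw [diag_apply, Matrix.mul_apply]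
    refine Finset.sum_congr rfl fun j _ => ?_
    rw [diagonal_mul, diagonal_mul]
    ring
  have amgm : ∀ i j, ‖P i j‖ * ‖Q j i‖ ≤ (‖P i j‖ ^ 2 + ‖Q j i‖ ^ 2) / 2 := fun i j => by
    nlinarith [sq_nonneg (‖P i j‖ - ‖Q j i‖)]
  calc ‖(S * (X * Y)).trace‖
      ≤ ∑ i, ∑ j, |hX.eigenvalues i| * |hY.eigenvalues j| * (‖P i j‖ * ‖Q j i‖) := by
        rw [htr]
        refine (norm_sum_le _ _).trans (Finset.sum_le_sum fun i _ =>
          (norm_sum_le _ _).trans (Finset.sum_le_sum fun j _ => ?_))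
        simp only [norm_mul, Complex.norm_real, Real.norm_eq_abs, le_refl]
    _ ≤ _ := by
        refine sum_mul_mul_le_of_doubly_substochastic hpq (fun i j => ‖P i j‖ * ‖Q j i‖)
          (fun i j => by positivity) (fun i => ?_) (fun j => ?_) _ _
          (fun i => abs_nonneg _) (fun j => abs_nonneg _)
        · refine (Finset.sum_le_sum fun j _ => amgm i j).trans ?_
          rw [← Finset.sum_div, Finset.sum_add_distrib, sum_norm_sq_row_of_mem_unitaryGroup hPm,
            sum_norm_sq_col_of_mem_unitaryGroup hQm]
          norm_num
        · refine (Finset.sum_le_sum fun i _ => amgm i j).trans ?_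
          rw [← Finset.sum_div, Finset.sum_add_distrib, sum_norm_sq_col_of_mem_unitaryGroup hPm,
            sum_norm_sq_row_of_mem_unitaryGroup hQm]
          norm_num

/-- The trace norm of a Hermitian matrix is attained by pairing with a unitary matrix. -/
theorem Matrix.IsHermitian.exists_unitary_trace_mul_eq_sum_abs {n : Type*} [Fintype n]
    [DecidableEq n] {J : Matrix n n ℂ} (hJ : J.IsHermitian) :
    ∃ S ∈ unitaryGroup n ℂ, (S * J).trace = ((∑ i, |hJ.eigenvalues i| : ℝ) : ℂ) := by
  set W : Matrix n n ℂ := ↑hJ.eigenvectorUnitary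
  have hWm : W ∈ unitaryGroup n ℂ := hJ.eigenvectorUnitary.2
  have eJ : J = W * diagonal (fun i => (hJ.eigenvalues i : ℂ)) * star W := by
    conv_lhs => rw [hJ.spectral_theorem, Unitary.conjStarAlgAut_apply]
    rfl
  set s : n → ℂ := fun i => if 0 ≤ hJ.eigenvalues i then 1 else -1 with hs
  have hD : diagonal s ∈ unitaryGroup n ℂ := by
    rw [mem_unitaryGroup_iff, star_eq_conjTranspose, diagonal_conjTranspose, diagonal_mul_diagonal,
      ← diagonal_one]
    congr 1
    funext i
    by_cases h : 0 ≤ hJ.eigenvalues i <;> simp [hs, h]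
  refine ⟨W * diagonal s * star W, mul_mem (mul_mem hWm hD) (Unitary.star_mem hWm), ?_⟩
  have hWW : star W * W = 1 := mem_unitaryGroup_iff'.mp hWm
  have h : (W * diagonal s * star W * J).trace =
      (diagonal s * diagonal (fun i => (hJ.eigenvalues i : ℂ))).trace := by
    conv_lhs => rw [eJ]
    calc _ = (W * (diagonal s * (star W * W) *
          diagonal (fun i => (hJ.eigenvalues i : ℂ)) * star W)).trace := by
          simp only [Matrix.mul_assoc]
      _ = _ := by
          rw [Matrix.trace_mul_comm, hWW, Matrix.mul_one, Matrix.mul_assoc, hWW, Matrix.mul_one]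
  rw [h, diagonal_mul_diagonal, trace_diagonal, Complex.ofReal_sum]
  refine Finset.sum_congr rfl fun i _ => ?_
  by_cases h : 0 ≤ hJ.eigenvalues i
  · simp [hs, h, abs_of_nonneg h]
  · simp [hs, h, abs_of_neg (not_le.mp h)]

/-- For complex Hermitian `X, Y` and conjugate exponents `p, q ∈ (1, ∞)`,
`‖X∘Y‖₁ ≤ ‖X‖ₚ ‖Y‖_q`, where `X∘Y = (XY + YX)/2` is the Jordan product. -/
theorem spectralPNormC_one_jordan_le {n : ℕ}
    (X Y : Matrix (Fin n) (Fin n) ℂ) (hX : X.IsHermitian) (hY : Y.IsHermitian)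
    (hJ : ((1 / 2 : ℂ) • (X * Y + Y * X)).IsHermitian)
    (p q : ℝ) (hp : 1 < p) (hq : 1 < q) (hpq : 1 / p + 1 / q = 1) :
    spectralPNormC 1 hJ ≤ spectralPNormC p hX * spectralPNormC q hY := by
  have hc : p.HolderConjugate q :=
    Real.holderConjugate_iff.mpr ⟨hp, by simpa only [one_div] using hpq⟩
  obtain ⟨S, hS, hSJ⟩ := hJ.exists_unitary_trace_mul_eq_sum_abs
  have hnorm : spectralPNormC 1 hJ = ‖(S * ((1 / 2 : ℂ) • (X * Y + Y * X))).trace‖ := by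
    rw [hSJ, Complex.norm_real, Real.norm_of_nonneg (Finset.sum_nonneg fun i _ => abs_nonneg _)]
    simp [spectralPNormC]
  have hXY := norm_trace_unitary_mul_mul_le hS hX hY hc
  have hYX := norm_trace_unitary_mul_mul_le hS hY hX hc.symm
  rw [hnorm, Matrix.mul_smul, trace_smul, Matrix.mul_add, trace_add, norm_smul]
  have hadd := norm_add_le (S * (X * Y)).trace (S * (Y * X)).trace
  have hhalf : ‖(1 / 2 : ℂ)‖ = 1 / 2 := by norm_num
  rw [hhalf]
  linarith [mul_comm (spectralPNormC p hX) (spectralPNormC q hY)]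
end

section
/- Let X and Y be n×n real symmetric matrices and let p ≥ 1 be a real number. Then ‖X∘Y‖ₚ ≤ ‖X‖ₚ · ‖Y‖_∞, i.e., the spectral p-norm of (XY + YX)/2 is at most the spectral p-norm of X times the maximum absolute value of an eigenvalue of Y. -/
open Matrix

/-- The spectral `∞`-norm of a symmetric/Hermitian matrix: `‖X‖_∞ = maxᵢ |λᵢ(X)|`. -/
noncomputable def spectralSupNorm {n : ℕ} {X : Matrix (Fin n) (Fin n) ℝ}
    (hX : X.IsHermitian) : ℝ :=
  ⨆ i, |hX.eigenvalues i|

open scoped RealInnerProductSpace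

/-- **Schur test** for a nonnegative matrix whose row and column sums are at most `L`. -/
lemma sum_rpow_sum_mul_le {ι κ : Type*} [Fintype ι] [Fintype κ] {p L : ℝ} (hp : 1 ≤ p)
    (hL : 0 ≤ L) {M : κ → ι → ℝ} (hM : ∀ k i, 0 ≤ M k i) (hrow : ∀ k, ∑ i, M k i ≤ L)
    (hcol : ∀ i, ∑ k, M k i ≤ L) {a : ι → ℝ} (ha : ∀ i, 0 ≤ a i) :
    ∑ k, (∑ i, M k i * a i) ^ p ≤ L ^ p * ∑ i, a i ^ p := by
  have hp0 : 0 < p := by linarith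
  have hap (i : ι) : 0 ≤ a i ^ p := Real.rpow_nonneg (ha i) p
  have key (k : κ) : (∑ i, M k i * a i) ^ p ≤ L ^ (p - 1) * ∑ i, M k i * a i ^ p := by
    have hS : 0 ≤ ∑ i, M k i := Finset.sum_nonneg fun i _ ↦ hM k i
    have hT : 0 ≤ ∑ i, M k i * a i ^ p :=
      Finset.sum_nonneg fun i _ ↦ mul_nonneg (hM k i) (hap i)
    calc (∑ i, M k i * a i) ^ p
        ≤ ((∑ i, M k i) ^ (1 - p⁻¹) * (∑ i, M k i * a i ^ p) ^ p⁻¹) ^ p :=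
          Real.rpow_le_rpow (Finset.sum_nonneg fun i _ ↦ mul_nonneg (hM k i) (ha i))
            (Real.inner_le_weight_mul_Lp_of_nonneg _ hp _ _ (hM k) ha) hp0.le
      _ = (∑ i, M k i) ^ (p - 1) * ∑ i, M k i * a i ^ p := by
          rw [Real.mul_rpow (by positivity) (by positivity), ← Real.rpow_mul hS,
            ← Real.rpow_mul hT, inv_mul_cancel₀ hp0.ne', Real.rpow_one, sub_mul,
            inv_mul_cancel₀ hp0.ne', one_mul]
      _ ≤ L ^ (p - 1) * ∑ i, M k i * a i ^ p := by
          gcongr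
          exact hrow k
  calc ∑ k, (∑ i, M k i * a i) ^ p
      ≤ ∑ k, L ^ (p - 1) * ∑ i, M k i * a i ^ p := Finset.sum_le_sum fun k _ ↦ key k
    _ = L ^ (p - 1) * ∑ i, (∑ k, M k i) * a i ^ p := by
        rw [← Finset.mul_sum, Finset.sum_comm]
        simp_rw [Finset.sum_mul]
    _ ≤ L ^ (p - 1) * ∑ i, L * a i ^ p := by
        gcongr with i
        · exact hap i
        · exact hcol i
    _ = L ^ p * ∑ i, a i ^ p := by
        rw [← Finset.mul_sum, ← mul_assoc]
        congr 1
        nth_rewrite 2 [← Real.rpow_one L]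
        rw [← Real.rpow_add_of_nonneg hL (by linarith) zero_le_one, sub_add_cancel]

lemma OrthonormalBasis.sum_abs_inner_mul_abs_inner_le {ι E : Type*} [Fintype ι]
    [NormedAddCommGroup E] [InnerProductSpace ℝ E] (b : OrthonormalBasis ι ℝ E) (x y : E) :
    ∑ i, |⟪x, b i⟫| * |⟪b i, y⟫| ≤ ‖x‖ * ‖y‖ := by
  refine abs_le_of_sq_le_sq' ?_ (by positivity) |>.2
  refine (Finset.sum_mul_sq_le_sq_mul_sq _ _ _).trans_eq ?_
  simp_rw [sq_abs]
  rw [b.sum_sq_inner_left, b.sum_sq_inner_right, mul_pow]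

namespace Matrix.IsHermitian

variable {n : Type*} [Fintype n] [DecidableEq n] {A : Matrix n n ℝ}

lemma inner_toEuclideanLin_comm (hA : A.IsHermitian) (x y : EuclideanSpace ℝ n) :
    ⟪toEuclideanLin A x, y⟫ = ⟪x, toEuclideanLin A y⟫ :=
  isSymmetric_toEuclideanLin_iff.mpr hA x y

lemma toEuclideanLin_eigenvectorBasis (hA : A.IsHermitian) (i : n) :
    toEuclideanLin A (hA.eigenvectorBasis i) = hA.eigenvalues i • hA.eigenvectorBasis i := by
  rw [toLpLin_apply, hA.mulVec_eigenvectorBasis]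
  rfl

lemma inner_toEuclideanLin_eigenvectorBasis (hA : A.IsHermitian) (x : EuclideanSpace ℝ n)
    (i : n) : ⟪toEuclideanLin A x, hA.eigenvectorBasis i⟫ =
      hA.eigenvalues i * ⟪x, hA.eigenvectorBasis i⟫ := by
  rw [hA.inner_toEuclideanLin_comm, hA.toEuclideanLin_eigenvectorBasis, real_inner_smul_right]

lemma norm_toEuclideanLin_le (hA : A.IsHermitian) {L : ℝ} (hL : 0 ≤ L)
    (h : ∀ i, |hA.eigenvalues i| ≤ L) (x : EuclideanSpace ℝ n) :
    ‖toEuclideanLin A x‖ ≤ L * ‖x‖ := by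
  refine abs_le_of_sq_le_sq' ?_ (by positivity) |>.2
  rw [mul_pow, ← hA.eigenvectorBasis.sum_sq_inner_left,
    ← hA.eigenvectorBasis.sum_sq_inner_left x, Finset.mul_sum]
  refine Finset.sum_le_sum fun i _ ↦ ?_
  rw [hA.inner_toEuclideanLin_eigenvectorBasis, mul_pow]
  exact mul_le_mul_of_nonneg_right (sq_le_sq' (abs_le.mp (h i)).1 (abs_le.mp (h i)).2)
    (sq_nonneg _)

end Matrix.IsHermitian

lemma Matrix.inner_jordan_self {n : Type*} [Fintype n] [DecidableEq n] {X Y : Matrix n n ℝ}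
    (hX : X.IsHermitian) (hY : Y.IsHermitian) (x : EuclideanSpace ℝ n) :
    ⟪toEuclideanLin ((1 / 2 : ℝ) • (X * Y + Y * X)) x, x⟫ =
      ⟪toEuclideanLin X x, toEuclideanLin Y x⟫ := by
  have hXY : toEuclideanLin (X * Y) x = toEuclideanLin X (toEuclideanLin Y x) := by
    simp [toLpLin_apply]
  have hYX : toEuclideanLin (Y * X) x = toEuclideanLin Y (toEuclideanLin X x) := by
    simp [toLpLin_apply]
  rw [map_smul, map_add, LinearMap.smul_apply, LinearMap.add_apply, hXY, hYX,
    real_inner_smul_left, inner_add_left, hX.inner_toEuclideanLin_comm (toEuclideanLin Y x),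
    hY.inner_toEuclideanLin_comm (toEuclideanLin X x), real_inner_comm (toEuclideanLin X x)]
  ring

/-- For real symmetric `X, Y` and `p ≥ 1`,
`‖X∘Y‖ₚ ≤ ‖X‖ₚ ‖Y‖_∞`, where `X∘Y = (XY + YX)/2` is the Jordan product. -/
theorem spectralPNorm_jordan_le_mul_supNorm {n : ℕ}
    (X Y : Matrix (Fin n) (Fin n) ℝ) (hX : X.IsHermitian) (hY : Y.IsHermitian)
    (hJ : ((1 / 2 : ℝ) • (X * Y + Y * X)).IsHermitian)
    (p : ℝ) (hp : 1 ≤ p) :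
    spectralPNorm p hJ ≤ spectralPNorm p hX * spectralSupNorm hY := by
  have hp0 : 0 < p := by linarith
  unfold spectralPNorm spectralSupNorm
  set L := ⨆ i, |hY.eigenvalues i|
  have hL : 0 ≤ L := Real.iSup_nonneg fun i ↦ abs_nonneg _
  have hYL : ∀ i, |hY.eigenvalues i| ≤ L :=
    le_ciSup (f := fun i ↦ |hY.eigenvalues i|) (Set.finite_range _).bddAbove
  set w := hJ.eigenvectorBasis
  set u := hX.eigenvectorBasis
  let M : Fin n → Fin n → ℝ := fun k i ↦ |⟪w k, u i⟫| * |⟪u i, toEuclideanLin Y (w k)⟫|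
  have hev (k : Fin n) : |hJ.eigenvalues k| ≤ ∑ i, M k i * |hX.eigenvalues i| := by
    have h : hJ.eigenvalues k =
        ∑ i, hX.eigenvalues i * ⟪w k, u i⟫ * ⟪u i, toEuclideanLin Y (w k)⟫ := by
      have h1 := hJ.inner_toEuclideanLin_eigenvectorBasis (w k) k
      rw [real_inner_self_eq_norm_sq, w.norm_eq_one, one_pow, mul_one,
        inner_jordan_self hX hY, ← u.sum_inner_mul_inner] at h1
      simp_rw [← h1, u, hX.inner_toEuclideanLin_eigenvectorBasis]
    rw [h]
    refine (Finset.abs_sum_le_sum_abs _ _).trans_eq (Finset.sum_congr rfl fun i _ ↦ ?_)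
    rw [abs_mul, abs_mul]
    ring
  have hrow (k : Fin n) : ∑ i, M k i ≤ L := by
    refine (u.sum_abs_inner_mul_abs_inner_le _ _).trans ?_
    simpa using hY.norm_toEuclideanLin_le hL hYL (w k)
  have hcol (i : Fin n) : ∑ k, M k i ≤ L := by
    have h := w.sum_abs_inner_mul_abs_inner_le (toEuclideanLin Y (u i)) (u i)
    refine le_trans (le_of_eq (Finset.sum_congr rfl fun k _ ↦ ?_)) (h.trans ?_)
    · rw [hY.inner_toEuclideanLin_comm, mul_comm]
    · simpa using hY.norm_toEuclideanLin_le hL hYL (u i)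
  have hsum : ∑ k, |hJ.eigenvalues k| ^ p ≤ L ^ p * ∑ i, |hX.eigenvalues i| ^ p :=
    (Finset.sum_le_sum fun k _ ↦ Real.rpow_le_rpow (abs_nonneg _) (hev k) hp0.le).trans
      (sum_rpow_sum_mul_le hp hL (fun _ _ ↦ by positivity) hrow hcol fun _ ↦ abs_nonneg _)
  calc (∑ k, |hJ.eigenvalues k| ^ p) ^ (1 / p)
      ≤ (L ^ p * ∑ i, |hX.eigenvalues i| ^ p) ^ (1 / p) := by gcongr
    _ = (∑ i, |hX.eigenvalues i| ^ p) ^ (1 / p) * L := by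
        rw [Real.mul_rpow (by positivity) (by positivity), ← Real.rpow_mul hL,
          mul_one_div_cancel hp0.ne', Real.rpow_one, mul_comm]
end

section
/- Let P and Q be linear maps on the space of n×n real symmetric matrices such that P maps positive semidefinite matrices to positive semidefinite matrices and tr(P(X)·Y) = tr(X·Q(Y)) for all symmetric X, Y (Q is the adjoint of P with respect to the trace inner product). Let p, q ∈ (1, ∞) be real numbers with 1/p + 1/q = 1. Then for every n×n real symmetric matrix X, ‖P(X)‖₁ ≤ ‖X‖ₚ · ‖Q(I)‖_q. -/
open Matrix

/-- **Hölder's inequality** with doubly stochastic weights. -/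
theorem Real.sum_weights_mul_le_Lp_mul_Lq {ι κ : Type*} [Fintype ι] [Fintype κ]
    {p q : ℝ} (hpq : p.HolderConjugate q) {D : ι → κ → ℝ} (hD : ∀ i j, 0 ≤ D i j)
    (hrow : ∀ i, ∑ j, D i j = 1) (hcol : ∀ j, ∑ i, D i j = 1)
    {a : ι → ℝ} {b : κ → ℝ} (ha : ∀ i, 0 ≤ a i) (hb : ∀ j, 0 ≤ b j) :
    ∑ i, ∑ j, D i j * (a i * b j) ≤ (∑ i, a i ^ p) ^ (1 / p) * (∑ j, b j ^ q) ^ (1 / q) := by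
  have h := Real.inner_le_Lp_mul_Lq_of_nonneg (Finset.univ : Finset (ι × κ))
    (f := fun x ↦ D x.1 x.2 ^ (1 / p) * a x.1) (g := fun x ↦ D x.1 x.2 ^ (1 / q) * b x.2) hpq
    (fun x _ ↦ mul_nonneg (Real.rpow_nonneg (hD _ _) _) (ha _))
    (fun x _ ↦ mul_nonneg (Real.rpow_nonneg (hD _ _) _) (hb _))
  have hweight (i : ι) (j : κ) : D i j ^ (1 / p) * D i j ^ (1 / q) = D i j := by
    have hsum : 1 / p + 1 / q = 1 := by simpa using hpq.inv_add_inv_eq_one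
    rw [← Real.rpow_add_of_nonneg (hD i j) hpq.one_div_nonneg hpq.symm.one_div_nonneg, hsum,
      Real.rpow_one]
  have hroot {r : ℝ} (hr : r ≠ 0) {x y : ℝ} (hx : 0 ≤ x) (hy : 0 ≤ y) :
      (x ^ (1 / r) * y) ^ r = x * y ^ r := by
    rw [Real.mul_rpow (Real.rpow_nonneg hx _) hy, ← Real.rpow_mul hx, one_div_mul_cancel hr,
      Real.rpow_one]
  simp only [Fintype.sum_prod_type, hroot hpq.ne_zero (hD _ _) (ha _),
    hroot hpq.symm.ne_zero (hD _ _) (hb _)] at h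
  rw [Finset.sum_comm (f := fun i j ↦ D i j * b j ^ q)] at h
  simp only [← Finset.sum_mul, hrow, hcol, one_mul] at h
  refine le_trans (le_of_eq ?_) h
  refine Finset.sum_congr rfl fun i _ ↦ Finset.sum_congr rfl fun j _ ↦ ?_
  rw [mul_mul_mul_comm, hweight]

namespace Matrix

variable {n : Type*} [Fintype n] [DecidableEq n]

theorem sum_dotProduct_mulVec_orthonormalBasis {ι : Type*} [Fintype ι]
    (b : OrthonormalBasis ι ℝ (EuclideanSpace ℝ n)) (A : Matrix n n ℝ) :
    ∑ i, ⇑(b i) ⬝ᵥ A *ᵥ ⇑(b i) = A.trace := by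
  have h := LinearMap.trace_eq_sum_inner (Matrix.toEuclideanLin A) b
  have htrace : LinearMap.trace ℝ _ (Matrix.toEuclideanLin A) = A.trace := by
    rw [LinearMap.trace_eq_matrix_trace ℝ (EuclideanSpace.basisFun n ℝ).toBasis,
      Matrix.toEuclideanLin_eq_toLin_orthonormal, LinearMap.toMatrix_toLin]
  rw [← htrace, h]
  refine Finset.sum_congr rfl fun i _ ↦ ?_
  simp [EuclideanSpace.inner_eq_star_dotProduct, dotProduct_comm]

theorem IsHermitian.eq_sum_eigenvalues_smul_vecMulVec {A : Matrix n n ℝ} (hA : A.IsHermitian) :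
    A = ∑ i, hA.eigenvalues i •
      vecMulVec ⇑(hA.eigenvectorBasis i) ⇑(hA.eigenvectorBasis i) := by
  conv_lhs => rw [hA.spectral_theorem, Unitary.conjStarAlgAut_apply]
  ext i j
  simp only [mul_apply, diagonal, Matrix.sum_apply, smul_apply, vecMulVec_apply, smul_eq_mul]
  refine Finset.sum_congr rfl fun k _ ↦ ?_
  simp [star_apply]
  ring

theorem IsHermitian.dotProduct_mulVec_eq_sum {A : Matrix n n ℝ} (hA : A.IsHermitian)
    (v : EuclideanSpace ℝ n) :
    ⇑v ⬝ᵥ A *ᵥ ⇑v = ∑ j, inner ℝ v (hA.eigenvectorBasis j) ^ 2 * hA.eigenvalues j := by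
  conv_lhs => rw [hA.eq_sum_eigenvalues_smul_vecMulVec]
  rw [sum_mulVec, dotProduct_sum]
  refine Finset.sum_congr rfl fun j _ ↦ ?_
  rw [smul_mulVec, vecMulVec_mulVec]
  simp [EuclideanSpace.inner_eq_star_dotProduct, dotProduct_comm]
  ring

/-- The trace norm of the image of a Hermitian matrix under a positive map is bounded by the
traces of the images of its spectral projections, weighted by the absolute eigenvalues. -/
theorem IsHermitian.sum_abs_eigenvalues_map_le
    (P : Matrix n n ℝ →ₗ[ℝ] Matrix n n ℝ)
    (hP : ∀ X : Matrix n n ℝ, X.PosSemidef → (P X).PosSemidef)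
    {X : Matrix n n ℝ} (hX : X.IsHermitian) (hPX : (P X).IsHermitian) :
    ∑ k, |hPX.eigenvalues k| ≤ ∑ i, |hX.eigenvalues i| *
      (P (vecMulVec ⇑(hX.eigenvectorBasis i) ⇑(hX.eigenvectorBasis i))).trace := by
  set E : n → Matrix n n ℝ :=
    fun i ↦ vecMulVec ⇑(hX.eigenvectorBasis i) ⇑(hX.eigenvectorBasis i) with hE
  have hPE (i : n) : (P (E i)).PosSemidef :=
    hP _ (by simpa using posSemidef_vecMulVec_self_star ⇑(hX.eigenvectorBasis i))
  have hPsum : P X = ∑ i, hX.eigenvalues i • P (E i) := by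
    conv_lhs => rw [hX.eq_sum_eigenvalues_smul_vecMulVec]
    simp [hE]
  have hquad (v : n → ℝ) :
      v ⬝ᵥ P X *ᵥ v = ∑ i, hX.eigenvalues i * (v ⬝ᵥ P (E i) *ᵥ v) := by
    simp [hPsum, sum_mulVec, dotProduct_sum, smul_mulVec]
  calc ∑ k, |hPX.eigenvalues k|
      ≤ ∑ k, ∑ i, |hX.eigenvalues i| *
          (⇑(hPX.eigenvectorBasis k) ⬝ᵥ P (E i) *ᵥ ⇑(hPX.eigenvectorBasis k)) := by
        refine Finset.sum_le_sum fun k _ ↦ ?_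
        rw [hPX.eigenvalues_eq]
        simp only [star_trivial, RCLike.re_to_real]
        rw [hquad]
        refine (Finset.abs_sum_le_sum_abs _ _).trans (le_of_eq ?_)
        refine Finset.sum_congr rfl fun i _ ↦ ?_
        rw [abs_mul, abs_of_nonneg (a := _ ⬝ᵥ _)]
        simpa using (hPE i).dotProduct_mulVec_nonneg ⇑(hPX.eigenvectorBasis k)
    _ = ∑ i, |hX.eigenvalues i| * (P (E i)).trace := by
        rw [Finset.sum_comm]
        simp only [← Finset.mul_sum, sum_dotProduct_mulVec_orthonormalBasis]

end Matrix

/-- If `P` is a positive linear map on real symmetric matrices (it maps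
symmetric matrices to symmetric matrices and positive semidefinite ones to positive
semidefinite ones) and `Q` is its adjoint with respect to the trace inner product, then
for conjugate exponents `p, q ∈ (1, ∞)` and every symmetric `X`,
`‖P(X)‖₁ ≤ ‖X‖ₚ ‖Q(I)‖_q`. -/
theorem spectralPNorm_one_positive_map_le {n : ℕ}
    (P Q : Matrix (Fin n) (Fin n) ℝ →ₗ[ℝ] Matrix (Fin n) (Fin n) ℝ)
    (hPherm : ∀ X : Matrix (Fin n) (Fin n) ℝ, X.IsHermitian → (P X).IsHermitian)
    (hQherm : ∀ X : Matrix (Fin n) (Fin n) ℝ, X.IsHermitian → (Q X).IsHermitian)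
    (hPpos : ∀ X : Matrix (Fin n) (Fin n) ℝ, X.PosSemidef → (P X).PosSemidef)
    (hadj : ∀ X Y : Matrix (Fin n) (Fin n) ℝ, X.IsHermitian → Y.IsHermitian →
      (P X * Y).trace = (X * Q Y).trace)
    (p q : ℝ) (hp : 1 < p) (hq : 1 < q) (hpq : 1 / p + 1 / q = 1)
    (X : Matrix (Fin n) (Fin n) ℝ) (hX : X.IsHermitian) :
    spectralPNorm 1 (hPherm X hX) ≤
      spectralPNorm p hX * spectralPNorm q (hQherm 1 Matrix.isHermitian_one) := by
  have hQ := hQherm 1 Matrix.isHermitian_one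
  have hconj : p.HolderConjugate q := Real.holderConjugate_iff.mpr ⟨hp, by simpa using hpq⟩
  have htrace (i : Fin n) :
      (P (vecMulVec ⇑(hX.eigenvectorBasis i) ⇑(hX.eigenvectorBasis i))).trace =
        ∑ j, inner ℝ (hX.eigenvectorBasis i) (hQ.eigenvectorBasis j) ^ 2 * hQ.eigenvalues j := by
    have hE : (vecMulVec ⇑(hX.eigenvectorBasis i) ⇑(hX.eigenvectorBasis i)).IsHermitian := by
      simpa using (posSemidef_vecMulVec_self_star ⇑(hX.eigenvectorBasis i)).isHermitian
    rw [← hQ.dotProduct_mulVec_eq_sum, ← mul_one (P _), hadj _ _ hE isHermitian_one,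
      vecMulVec_mul, trace_vecMulVec, dotProduct_mulVec, dotProduct_comm]
  have hone : spectralPNorm 1 (hPherm X hX) = ∑ k, |(hPherm X hX).eigenvalues k| := by
    simp [spectralPNorm]
  rw [hone]
  refine (hX.sum_abs_eigenvalues_map_le P hPpos (hPherm X hX)).trans ?_
  refine le_trans ?_ (Real.sum_weights_mul_le_Lp_mul_Lq hconj
    (D := fun i j ↦ inner ℝ (hX.eigenvectorBasis i) (hQ.eigenvectorBasis j) ^ 2)
    (fun _ _ ↦ sq_nonneg _)
    (fun i ↦ by simp [hQ.eigenvectorBasis.sum_sq_inner_left])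
    (fun j ↦ by simp [hX.eigenvectorBasis.sum_sq_inner_right])
    (fun i ↦ abs_nonneg (hX.eigenvalues i)) (fun j ↦ abs_nonneg (hQ.eigenvalues j)))
  refine Finset.sum_le_sum fun i _ ↦ ?_
  rw [htrace, Finset.mul_sum]
  refine Finset.sum_le_sum fun j _ ↦ ?_
  rw [mul_left_comm]
  gcongr
  exact le_abs_self _
end

section
/- Let P be a linear map on the space of n×n real symmetric matrices that maps positive semidefinite matrices to positive semidefinite matrices, and let p ≥ 1 be a real number. Then for every n×n real symmetric matrix X, ‖P(X)‖ₚ ≤ ‖X‖_∞ · ‖P(I)‖ₚ. -/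
open Matrix

open scoped RealInnerProductSpace

namespace Matrix.IsHermitian

variable {ι : Type*} [Fintype ι] [DecidableEq ι]

/-- The quadratic form of a real symmetric matrix in coordinates of an orthonormal eigenbasis. -/
theorem dotProduct_mulVec_eq_sum_eigenvalues {A : Matrix ι ι ℝ} (hA : A.IsHermitian)
    (x : EuclideanSpace ℝ ι) :
    x.ofLp ⬝ᵥ A *ᵥ x.ofLp = ∑ j, hA.eigenvalues j * ⟪hA.eigenvectorBasis j, x⟫ ^ 2 := by
  have hAt : Aᵀ = A := by simpa [IsHermitian] using hA
  have h := hA.eigenvectorBasis.sum_inner_mul_inner x (WithLp.toLp 2 (A *ᵥ x.ofLp))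
  have hx : ⟪x, WithLp.toLp 2 (A *ᵥ x.ofLp)⟫ = x.ofLp ⬝ᵥ A *ᵥ x.ofLp := by
    rw [EuclideanSpace.inner_eq_star_dotProduct, dotProduct_comm]
    simp
  rw [← hx, ← h]
  refine Finset.sum_congr rfl fun j _ => ?_
  have hj : ⟪hA.eigenvectorBasis j, WithLp.toLp 2 (A *ᵥ x.ofLp)⟫
      = hA.eigenvalues j * ⟪hA.eigenvectorBasis j, x⟫ := by
    simp only [EuclideanSpace.inner_eq_star_dotProduct, star_trivial]
    rw [dotProduct_comm, dotProduct_mulVec, ← mulVec_transpose, hAt,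
      hA.mulVec_eigenvectorBasis, smul_dotProduct, smul_eq_mul, dotProduct_comm]
  rw [hj, real_inner_comm x]
  ring

theorem abs_dotProduct_mulVec_le {A : Matrix ι ι ℝ} (hA : A.IsHermitian) {M : ℝ}
    (hM : ∀ i, |hA.eigenvalues i| ≤ M) (v : ι → ℝ) :
    |v ⬝ᵥ A *ᵥ v| ≤ M * (v ⬝ᵥ v) := by
  have hv : v ⬝ᵥ v = ∑ j, ⟪hA.eigenvectorBasis j, WithLp.toLp 2 v⟫ ^ 2 := by
    rw [hA.eigenvectorBasis.sum_sq_inner_right, EuclideanSpace.real_norm_sq_eq]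
    simp [dotProduct, sq]
  rw [hA.dotProduct_mulVec_eq_sum_eigenvalues (WithLp.toLp 2 v), hv, Finset.mul_sum]
  refine (Finset.abs_sum_le_sum_abs _ _).trans (Finset.sum_le_sum fun j _ => ?_)
  rw [abs_mul, abs_of_nonneg (sq_nonneg ⟪hA.eigenvectorBasis j, WithLp.toLp 2 v⟫)]
  exact mul_le_mul_of_nonneg_right (hM j) (sq_nonneg _)

theorem posSemidef_smul_one_sub {A : Matrix ι ι ℝ} (hA : A.IsHermitian) {M : ℝ}
    (hM : ∀ i, |hA.eigenvalues i| ≤ M) : (M • (1 : Matrix ι ι ℝ) - A).PosSemidef := by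
  refine .of_dotProduct_mulVec_nonneg ((isHermitian_one.smul (.all M)).sub hA) fun v => ?_
  have := (abs_le.mp (hA.abs_dotProduct_mulVec_le hM v)).2
  simpa [sub_mulVec, smul_mulVec] using this

theorem posSemidef_smul_one_add {A : Matrix ι ι ℝ} (hA : A.IsHermitian) {M : ℝ}
    (hM : ∀ i, |hA.eigenvalues i| ≤ M) : (M • (1 : Matrix ι ι ℝ) + A).PosSemidef := by
  refine .of_dotProduct_mulVec_nonneg ((isHermitian_one.smul (.all M)).add hA) fun v => ?_
  have := (abs_le.mp (hA.abs_dotProduct_mulVec_le hM v)).1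
  simp only [add_mulVec, smul_mulVec, star_trivial, one_mulVec, dotProduct_add, dotProduct_smul,
    smul_eq_mul]
  linarith

theorem dotProduct_mulVec_eigenvectorBasis {A : Matrix ι ι ℝ} (hA : A.IsHermitian) (i : ι) :
    (hA.eigenvectorBasis i).ofLp ⬝ᵥ A *ᵥ (hA.eigenvectorBasis i).ofLp = hA.eigenvalues i := by
  rw [hA.dotProduct_mulVec_eq_sum_eigenvalues]
  simp [hA.eigenvectorBasis.inner_eq_ite]

/-- Peierls' inequality for the power function: the diagonal of a positive semidefinite matrix in
any orthonormal basis is dominated in `p`-norm by its eigenvalues. -/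
theorem sum_rpow_dotProduct_mulVec_le {A : Matrix ι ι ℝ} (hA : A.IsHermitian)
    (hpos : ∀ i, 0 ≤ hA.eigenvalues i) (b : OrthonormalBasis ι ℝ (EuclideanSpace ℝ ι))
    {p : ℝ} (hp : 1 ≤ p) :
    ∑ i, ((b i).ofLp ⬝ᵥ A *ᵥ (b i).ofLp) ^ p ≤ ∑ j, hA.eigenvalues j ^ p := by
  have hrow (i : ι) : ∑ j, ⟪hA.eigenvectorBasis j, b i⟫ ^ 2 = 1 := by
    simp [hA.eigenvectorBasis.sum_sq_inner_right]
  have hcol (j : ι) : ∑ i, ⟪hA.eigenvectorBasis j, b i⟫ ^ 2 = 1 := by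
    simp [b.sum_sq_inner_left]
  calc ∑ i, ((b i).ofLp ⬝ᵥ A *ᵥ (b i).ofLp) ^ p
      ≤ ∑ i, ∑ j, ⟪hA.eigenvectorBasis j, b i⟫ ^ 2 * hA.eigenvalues j ^ p := by
        refine Finset.sum_le_sum fun i _ => ?_
        simp only [hA.dotProduct_mulVec_eq_sum_eigenvalues, mul_comm (hA.eigenvalues _)]
        exact Real.rpow_arith_mean_le_arith_mean_rpow _ _ _ (fun _ _ => sq_nonneg _) (hrow i)
          (fun j _ => hpos j) hp
    _ = ∑ j, hA.eigenvalues j ^ p := by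
        rw [Finset.sum_comm]
        simp_rw [← Finset.sum_mul, hcol, one_mul]

end Matrix.IsHermitian

/-- Monotonicity of the spectral `p`-norm: `-(M • B) ≤ A ≤ M • B` in the Loewner order implies
`‖A‖ₚ ≤ M ‖B‖ₚ`. -/
theorem spectralPNorm_le_mul_of_posSemidef {n : ℕ} {A B : Matrix (Fin n) (Fin n) ℝ}
    (hA : A.IsHermitian) (hB : B.IsHermitian) (hBpos : B.PosSemidef) {M : ℝ} (hM : 0 ≤ M)
    (hsub : (M • B - A).PosSemidef) (hadd : (M • B + A).PosSemidef) {p : ℝ} (hp : 1 ≤ p) :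
    spectralPNorm p hA ≤ M * spectralPNorm p hB := by
  have hp0 : 0 < p := by linarith
  have hpos (j : Fin n) : 0 ≤ hB.eigenvalues j := hBpos.eigenvalues_nonneg j
  have hform (v : Fin n → ℝ) : |v ⬝ᵥ A *ᵥ v| ≤ M * (v ⬝ᵥ B *ᵥ v) := by
    have h₁ := hsub.dotProduct_mulVec_nonneg v
    have h₂ := hadd.dotProduct_mulVec_nonneg v
    simp only [sub_mulVec, add_mulVec, smul_mulVec, star_trivial, dotProduct_sub, dotProduct_add,
      dotProduct_smul, smul_eq_mul] at h₁ h₂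
    exact abs_le.mpr ⟨by linarith, by linarith⟩
  have hsum : ∑ i, |hA.eigenvalues i| ^ p ≤ M ^ p * ∑ j, |hB.eigenvalues j| ^ p := by
    simp_rw [abs_of_nonneg (hpos _)]
    refine le_trans ?_ (mul_le_mul_of_nonneg_left
      (hB.sum_rpow_dotProduct_mulVec_le hpos hA.eigenvectorBasis hp) (Real.rpow_nonneg hM p))
    rw [Finset.mul_sum]
    refine Finset.sum_le_sum fun i _ => ?_
    rw [← Real.mul_rpow hM (by simpa using hBpos.dotProduct_mulVec_nonneg _)]
    refine Real.rpow_le_rpow (abs_nonneg _) ?_ hp0.le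
    simpa only [hA.dotProduct_mulVec_eigenvectorBasis] using hform (hA.eigenvectorBasis i).ofLp
  have hnonneg (C : Matrix (Fin n) (Fin n) ℝ) (hC : C.IsHermitian) :
      0 ≤ ∑ i, |hC.eigenvalues i| ^ p :=
    Finset.sum_nonneg fun i _ => Real.rpow_nonneg (abs_nonneg _) p
  calc spectralPNorm p hA ≤ (M ^ p * ∑ j, |hB.eigenvalues j| ^ p) ^ (1 / p) :=
        Real.rpow_le_rpow (hnonneg A hA) hsum (by positivity)
    _ = M * spectralPNorm p hB := by
        rw [Real.mul_rpow (Real.rpow_nonneg hM p) (hnonneg B hB), one_div,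
          Real.rpow_rpow_inv hM hp0.ne', spectralPNorm, one_div]

/-- If `P` is a positive linear map on real symmetric matrices (it maps
symmetric matrices to symmetric matrices and positive semidefinite ones to positive
semidefinite ones), then for `p ≥ 1` and every symmetric `X`,
`‖P(X)‖ₚ ≤ ‖X‖_∞ ‖P(I)‖ₚ`. -/
theorem spectralPNorm_positive_map_le {n : ℕ}
    (P : Matrix (Fin n) (Fin n) ℝ →ₗ[ℝ] Matrix (Fin n) (Fin n) ℝ)
    (hPherm : ∀ X : Matrix (Fin n) (Fin n) ℝ, X.IsHermitian → (P X).IsHermitian)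
    (hPpos : ∀ X : Matrix (Fin n) (Fin n) ℝ, X.PosSemidef → (P X).PosSemidef)
    (p : ℝ) (hp : 1 ≤ p)
    (X : Matrix (Fin n) (Fin n) ℝ) (hX : X.IsHermitian) :
    spectralPNorm p (hPherm X hX) ≤
      spectralSupNorm hX * spectralPNorm p (hPherm 1 Matrix.isHermitian_one) := by
  have hM (i : Fin n) : |hX.eigenvalues i| ≤ spectralSupNorm hX :=
    le_ciSup (f := fun i => |hX.eigenvalues i|) (Set.finite_range _).bddAbove i
  refine spectralPNorm_le_mul_of_posSemidef _ _ (hPpos 1 .one)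
    (M := spectralSupNorm hX) (Real.iSup_nonneg fun i => abs_nonneg _) ?_ ?_ hp
  · simpa using hPpos _ (hX.posSemidef_smul_one_sub hM)
  · simpa using hPpos _ (hX.posSemidef_smul_one_add hM)
end

section
/- Let A be any n×n real matrix, X an n×n real symmetric matrix, and p, q ∈ (1, ∞) real numbers with 1/p + 1/q = 1. Then ‖A X Aᵀ‖₁ ≤ ‖X‖ₚ · ‖AᵀA‖_q and ‖A X Aᵀ‖ₚ ≤ ‖X‖_∞ · ‖AAᵀ‖ₚ. -/
open Matrix

namespace Matrix.IsHermitian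

variable {n : Type*} [Fintype n] [DecidableEq n] {X : Matrix n n ℝ}

/-- The real orthogonal matrix whose columns are the eigenvectors of `X`. -/
noncomputable abbrev eigMat (hX : X.IsHermitian) : Matrix n n ℝ :=
  (hX.eigenvectorUnitary : Matrix n n ℝ)

lemma eigMat_mul_transpose (hX : X.IsHermitian) : hX.eigMat * hX.eigMatᵀ = 1 := by
  have h := Unitary.coe_mul_star_self hX.eigenvectorUnitary
  rwa [Unitary.coe_star, star_eq_conjTranspose, conjTranspose_eq_transpose_of_trivial] at h

lemma transpose_mul_eigMat (hX : X.IsHermitian) : hX.eigMatᵀ * hX.eigMat = 1 := by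
  have h := Unitary.coe_star_mul_self hX.eigenvectorUnitary
  rwa [star_eq_conjTranspose, conjTranspose_eq_transpose_of_trivial] at h

lemma eq_eigMat_conj_diagonal (hX : X.IsHermitian) :
    X = hX.eigMat * diagonal hX.eigenvalues * hX.eigMatᵀ := by
  have h := hX.spectral_theorem
  rw [Unitary.conjStarAlgAut_apply, star_eq_conjTranspose,
    conjTranspose_eq_transpose_of_trivial] at h
  exact h

lemma eigenvalues_eq_conj_apply (hX : X.IsHermitian) (i : n) :
    hX.eigenvalues i = (hX.eigMatᵀ * X * hX.eigMat) i i := by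
  have h : hX.eigMatᵀ * X * hX.eigMat = diagonal hX.eigenvalues := by
    rw [congrArg (hX.eigMatᵀ * · * hX.eigMat) hX.eq_eigMat_conj_diagonal]
    rw [← mul_assoc, ← mul_assoc, hX.transpose_mul_eigMat, one_mul, mul_assoc,
      hX.transpose_mul_eigMat, mul_one]
  rw [h, diagonal_apply_eq]

lemma transpose_mul_mul_apply_self (hX : X.IsHermitian) (W : Matrix n n ℝ) (i : n) :
    (Wᵀ * X * W) i i = ∑ j, (hX.eigMatᵀ * W) j i ^ 2 * hX.eigenvalues j := by
  have h : Wᵀ * X * W =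
      (hX.eigMatᵀ * W)ᵀ * diagonal hX.eigenvalues * (hX.eigMatᵀ * W) := by
    conv_lhs => rw [hX.eq_eigMat_conj_diagonal]
    simp only [transpose_mul, transpose_transpose, mul_assoc]
  rw [h, mul_apply]
  refine Finset.sum_congr rfl fun j _ => ?_
  rw [mul_diagonal, transpose_apply]
  ring

lemma abs_transpose_mul_mul_apply_self_le (hX : X.IsHermitian) (W : Matrix n n ℝ) (i : n) :
    |(Wᵀ * X * W) i i| ≤ ∑ j, (hX.eigMatᵀ * W) j i ^ 2 * |hX.eigenvalues j| := by
  rw [hX.transpose_mul_mul_apply_self]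
  refine (Finset.abs_sum_le_sum_abs _ _).trans_eq (Finset.sum_congr rfl fun j _ => ?_)
  rw [abs_mul, abs_of_nonneg (sq_nonneg _)]

end Matrix.IsHermitian

namespace Matrix

variable {n : Type*} [Fintype n]

lemma sum_sq_col_eq (B : Matrix n n ℝ) (i : n) :
    ∑ j, B j i ^ 2 = (Bᵀ * B) i i := by
  simp [mul_apply, sq]

lemma sum_sq_row_eq (B : Matrix n n ℝ) (j : n) :
    ∑ i, B j i ^ 2 = (B * Bᵀ) j j := by
  simp [mul_apply, sq]

/-- The diagonal of a Hermitian matrix in any orthonormal basis has `p`-norm at most that of the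
spectrum. -/
lemma sum_abs_diag_conj_rpow_le [DecidableEq n] {X : Matrix n n ℝ} (hX : X.IsHermitian)
    {U : Matrix n n ℝ} (hU : U * Uᵀ = 1) {p : ℝ} (hp : 1 ≤ p) :
    ∑ i, |(Uᵀ * X * U) i i| ^ p ≤ ∑ j, |hX.eigenvalues j| ^ p := by
  set B := hX.eigMatᵀ * U with hB
  have hU' : Uᵀ * U = 1 := mul_eq_one_comm.mp hU
  have hcol (i : n) : ∑ j, B j i ^ 2 = 1 := by
    rw [sum_sq_col_eq, hB, transpose_mul, transpose_transpose, mul_assoc, ← mul_assoc hX.eigMat,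
      hX.eigMat_mul_transpose, one_mul, hU', one_apply_eq]
  have hrow (j : n) : ∑ i, B j i ^ 2 = 1 := by
    rw [sum_sq_row_eq, hB, transpose_mul, transpose_transpose, mul_assoc, ← mul_assoc U,
      hU, one_mul, hX.transpose_mul_eigMat, one_apply_eq]
  calc ∑ i, |(Uᵀ * X * U) i i| ^ p
      ≤ ∑ i, ∑ j, B j i ^ 2 * |hX.eigenvalues j| ^ p := by
        refine Finset.sum_le_sum fun i _ => ?_
        refine (Real.rpow_le_rpow (abs_nonneg _)
          (hX.abs_transpose_mul_mul_apply_self_le U i) (by linarith)).trans ?_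
        exact Real.rpow_arith_mean_le_arith_mean_rpow _ _ _ (fun j _ => sq_nonneg _) (hcol i)
          (fun j _ => abs_nonneg _) hp
    _ = ∑ j, |hX.eigenvalues j| ^ p := by
        rw [Finset.sum_comm]
        refine Finset.sum_congr rfl fun j _ => ?_
        rw [← Finset.sum_mul, hrow, one_mul]

end Matrix

/-- For any real `A`, symmetric `X`, and conjugate exponents `p, q ∈ (1, ∞)`,
`‖A X Aᵀ‖₁ ≤ ‖X‖ₚ ‖AᵀA‖_q` and `‖A X Aᵀ‖ₚ ≤ ‖X‖_∞ ‖AAᵀ‖ₚ`. -/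
theorem spectralPNorm_congr_transpose_le {n : ℕ}
    (A X : Matrix (Fin n) (Fin n) ℝ) (hX : X.IsHermitian)
    (h1 : (A * X * Aᵀ).IsHermitian) (h2 : (Aᵀ * A).IsHermitian)
    (h3 : (A * Aᵀ).IsHermitian)
    (p q : ℝ) (hp : 1 < p) (hq : 1 < q) (hpq : 1 / p + 1 / q = 1) :
    spectralPNorm 1 h1 ≤ spectralPNorm p hX * spectralPNorm q h2 ∧
    spectralPNorm p h1 ≤ spectralSupNorm hX * spectralPNorm p h3 := by
  have hμ (i : Fin n) : |h1.eigenvalues i| ≤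
      ∑ j, (hX.eigMatᵀ * (Aᵀ * h1.eigMat)) j i ^ 2 * |hX.eigenvalues j| := by
    have h := hX.abs_transpose_mul_mul_apply_self_le (Aᵀ * h1.eigMat) i
    rw [h1.eigenvalues_eq_conj_apply]
    simpa only [transpose_mul, transpose_transpose, mul_assoc] using h
  have hnorm {r : ℝ} {Y : Matrix (Fin n) (Fin n) ℝ} (hY : Y.IsHermitian) :
      0 ≤ ∑ i, |hY.eigenvalues i| ^ r :=
    Finset.sum_nonneg fun i _ => Real.rpow_nonneg (abs_nonneg _) _
  constructor
  · have hpq' : p.HolderConjugate q := by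
      rw [Real.holderConjugate_iff]
      exact ⟨hp, by simpa only [one_div] using hpq⟩
    have hrow (j : Fin n) : ∑ i, (hX.eigMatᵀ * (Aᵀ * h1.eigMat)) j i ^ 2 =
        (hX.eigMatᵀ * (Aᵀ * A) * hX.eigMat) j j := by
      rw [sum_sq_row_eq]
      simp only [transpose_mul, transpose_transpose, mul_assoc]
      rw [← mul_assoc h1.eigMat, h1.eigMat_mul_transpose, one_mul]
    simp only [spectralPNorm, Real.rpow_one, div_one]
    calc ∑ i, |h1.eigenvalues i|
        ≤ ∑ i, ∑ j, (hX.eigMatᵀ * (Aᵀ * h1.eigMat)) j i ^ 2 * |hX.eigenvalues j| :=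
          Finset.sum_le_sum fun i _ => hμ i
      _ = ∑ j, |hX.eigenvalues j| * (hX.eigMatᵀ * (Aᵀ * A) * hX.eigMat) j j := by
          rw [Finset.sum_comm]
          refine Finset.sum_congr rfl fun j _ => ?_
          rw [← Finset.sum_mul, hrow, mul_comm]
      _ ≤ (∑ j, |(|hX.eigenvalues j|)| ^ p) ^ (1 / p) *
          (∑ j, |(hX.eigMatᵀ * (Aᵀ * A) * hX.eigMat) j j| ^ q) ^ (1 / q) :=
          Real.inner_le_Lp_mul_Lq _ _ _ hpq'
      _ ≤ _ := by
          simp only [abs_abs]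
          refine mul_le_mul_of_nonneg_left (Real.rpow_le_rpow ?_
            (sum_abs_diag_conj_rpow_le h2 hX.eigMat_mul_transpose hq.le) (by positivity))
            (Real.rpow_nonneg (hnorm hX) _)
          exact Finset.sum_nonneg fun i _ => Real.rpow_nonneg (abs_nonneg _) _
  · have hΛ (j : Fin n) : |hX.eigenvalues j| ≤ spectralSupNorm hX :=
      le_ciSup (f := fun j => |hX.eigenvalues j|) (Set.finite_range _).bddAbove j
    have hΛ0 : 0 ≤ spectralSupNorm hX := Real.iSup_nonneg fun j => abs_nonneg _
    have hμ' (i : Fin n) : |h1.eigenvalues i| ≤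
        spectralSupNorm hX * |(h1.eigMatᵀ * (A * Aᵀ) * h1.eigMat) i i| := by
      have hcol : ∑ j, (hX.eigMatᵀ * (Aᵀ * h1.eigMat)) j i ^ 2 =
          (h1.eigMatᵀ * (A * Aᵀ) * h1.eigMat) i i := by
        rw [sum_sq_col_eq]
        simp only [transpose_mul, transpose_transpose, mul_assoc]
        rw [← mul_assoc hX.eigMat, hX.eigMat_mul_transpose, one_mul]
      calc |h1.eigenvalues i|
          ≤ ∑ j, (hX.eigMatᵀ * (Aᵀ * h1.eigMat)) j i ^ 2 * spectralSupNorm hX :=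
            (hμ i).trans (Finset.sum_le_sum fun j _ =>
              mul_le_mul_of_nonneg_left (hΛ j) (sq_nonneg _))
        _ = spectralSupNorm hX * (h1.eigMatᵀ * (A * Aᵀ) * h1.eigMat) i i := by
            rw [← Finset.sum_mul, hcol, mul_comm]
        _ ≤ _ := mul_le_mul_of_nonneg_left (le_abs_self _) hΛ0
    have hp0 : 0 < p := by linarith
    calc (∑ i, |h1.eigenvalues i| ^ p) ^ (1 / p)
        ≤ (spectralSupNorm hX ^ p * ∑ i, |h3.eigenvalues i| ^ p) ^ (1 / p) := by
          refine Real.rpow_le_rpow (hnorm h1) ?_ (by positivity)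
          refine le_trans ?_ (mul_le_mul_of_nonneg_left
            (sum_abs_diag_conj_rpow_le h3 h1.eigMat_mul_transpose hp.le)
            (Real.rpow_nonneg hΛ0 p))
          rw [Finset.mul_sum]
          refine Finset.sum_le_sum fun i _ => ?_
          rw [← Real.mul_rpow hΛ0 (abs_nonneg _)]
          exact Real.rpow_le_rpow (abs_nonneg _) (hμ' i) hp0.le
      _ = spectralSupNorm hX * spectralPNorm p h3 := by
          rw [Real.mul_rpow (Real.rpow_nonneg hΛ0 p) (hnorm h3), ← Real.rpow_mul hΛ0,
            mul_one_div_cancel hp0.ne', Real.rpow_one, spectralPNorm]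
end

section
/- Let A be an n×n real symmetric positive semidefinite matrix and X an n×n real symmetric matrix. Then ρ(A ∙ X) ≤ ρ(X) · max_{1≤i≤n} A_{ii}, where A ∙ X denotes the entrywise (Hadamard/Schur) product and ρ denotes the spectral radius (the maximum absolute value of an eigenvalue). -/
open Matrix

/-- The spectral radius (spectral `∞`-norm) of a symmetric matrix: `ρ(X) = maxᵢ |λᵢ(X)|`. -/
noncomputable def spectralRadius' {n : ℕ} {X : Matrix (Fin n) (Fin n) ℝ}
    (hX : X.IsHermitian) : ℝ :=
  ⨆ i, |hX.eigenvalues i|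

/-- A real symmetric matrix satisfies `X ≤ c • 1` in the Loewner order iff its eigenvalues are
at most `c`. -/
theorem Matrix.IsHermitian.posSemidef_algebraMap_sub_iff {ι : Type*} [Fintype ι] [DecidableEq ι]
    {X : Matrix ι ι ℝ} (hX : X.IsHermitian) (c : ℝ) :
    (algebraMap ℝ (Matrix ι ι ℝ) c - X).PosSemidef ↔ ∀ i, hX.eigenvalues i ≤ c := by
  have hc : (algebraMap ℝ (Matrix ι ι ℝ) c).IsHermitian := by
    simp [Matrix.IsHermitian, Matrix.algebraMap_eq_diagonal]
  rw [posSemidef_iff_isHermitian_and_spectrum_nonneg, ← spectrum.singleton_sub_eq,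
    hX.spectrum_real_eq_range_eigenvalues, and_iff_right (hc.sub hX), Set.singleton_sub]
  simp [Set.subset_def]

/-- A real symmetric matrix satisfies `-c • 1 ≤ X` in the Loewner order iff its eigenvalues are
at least `-c`. -/
theorem Matrix.IsHermitian.posSemidef_algebraMap_add_iff {ι : Type*} [Fintype ι] [DecidableEq ι]
    {X : Matrix ι ι ℝ} (hX : X.IsHermitian) (c : ℝ) :
    (algebraMap ℝ (Matrix ι ι ℝ) c + X).PosSemidef ↔ ∀ i, -c ≤ hX.eigenvalues i := by
  have hc : (algebraMap ℝ (Matrix ι ι ℝ) c).IsHermitian := by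
    simp [Matrix.IsHermitian, Matrix.algebraMap_eq_diagonal]
  rw [posSemidef_iff_isHermitian_and_spectrum_nonneg, ← spectrum.singleton_add_eq,
    hX.spectrum_real_eq_range_eigenvalues, and_iff_right (hc.add hX), Set.singleton_add,
    ← Set.range_comp, Set.range_subset_iff]
  simp [neg_le_iff_add_nonneg']

/-- Taking the Hadamard product with a positive semidefinite matrix whose diagonal is bounded by
`m` preserves the Loewner bound `-c • 1 ≤ Y`, up to the factor `m`. -/
theorem Matrix.PosSemidef.algebraMap_add_hadamard {ι : Type*} [Fintype ι] [DecidableEq ι]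
    {A Y : Matrix ι ι ℝ} (hA : A.PosSemidef) {c m : ℝ} (hc : 0 ≤ c) (hm : ∀ i, A i i ≤ m)
    (hY : (algebraMap ℝ (Matrix ι ι ℝ) c + Y).PosSemidef) :
    (algebraMap ℝ (Matrix ι ι ℝ) (c * m) + A ⊙ Y).PosSemidef := by
  have hd : (diagonal fun i ↦ c * (m - A i i)).PosSemidef :=
    PosSemidef.diagonal fun i ↦ mul_nonneg hc (sub_nonneg.2 (hm i))
  have hsum : algebraMap ℝ (Matrix ι ι ℝ) (c * m) + A ⊙ Y =
      A ⊙ (algebraMap ℝ (Matrix ι ι ℝ) c + Y) + diagonal fun i ↦ c * (m - A i i) := by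
    ext i j
    obtain rfl | h := eq_or_ne i j
    · simp [Matrix.algebraMap_eq_diagonal]
      ring
    · simp [Matrix.algebraMap_eq_diagonal, h]
  rw [hsum]
  exact (hA.hadamard hY).add hd

/-- For a real symmetric positive semidefinite `A` and real symmetric `X`,
`ρ(A ∙ X) ≤ ρ(X) · maxᵢ Aᵢᵢ`, where `A ∙ X` is the Hadamard (entrywise) product. -/
theorem spectralRadius_hadamard_le {n : ℕ}
    (A X : Matrix (Fin n) (Fin n) ℝ) (hA : A.PosSemidef) (hX : X.IsHermitian)
    (hAX : (Matrix.hadamard A X).IsHermitian) :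
    spectralRadius' hAX ≤ spectralRadius' hX * ⨆ i, A i i := by
  have hm : ∀ i, A i i ≤ ⨆ i, A i i := le_ciSup (Set.finite_range fun i ↦ A i i).bddAbove
  have hr : ∀ i, |hX.eigenvalues i| ≤ spectralRadius' hX :=
    le_ciSup (Set.finite_range fun i ↦ |hX.eigenvalues i|).bddAbove
  have hr0 : 0 ≤ spectralRadius' hX := Real.iSup_nonneg fun i ↦ abs_nonneg _
  have lower := hA.algebraMap_add_hadamard hr0 hm
    ((hX.posSemidef_algebraMap_add_iff _).2 fun i ↦ (abs_le.1 (hr i)).1)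
  have upper := hA.algebraMap_add_hadamard (Y := -X) hr0 hm <| by
    rw [← sub_eq_add_neg]
    exact (hX.posSemidef_algebraMap_sub_iff _).2 fun i ↦ (abs_le.1 (hr i)).2
  have hneg : A ⊙ (-X) = -(A ⊙ X) := by ext; simp
  rw [hneg, ← sub_eq_add_neg] at upper
  exact Real.iSup_le
    (fun i ↦ abs_le.2 ⟨(hAX.posSemidef_algebraMap_add_iff _).1 lower i,
      (hAX.posSemidef_algebraMap_sub_iff _).1 upper i⟩)
    (mul_nonneg hr0 (Real.iSup_nonneg fun _ ↦ hA.diag_nonneg))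
end

section
/- Let A and X be n×n real symmetric matrices. Then A X A is majorized by A²∘X = (A²X + XA²)/2: there exists a doubly stochastic n×n matrix D such that the eigenvalue vector of A X A equals D applied to the eigenvalue vector of (A²X + XA²)/2 (eigenvalues counted with multiplicity). -/
open Matrix

/-- A real `n × n` matrix is doubly stochastic if its entries are nonnegative and
every row sum and every column sum equals `1`. -/
def IsDoublyStochastic {n : ℕ} (D : Matrix (Fin n) (Fin n) ℝ) : Prop :=
  (∀ i j, 0 ≤ D i j) ∧ (∀ i, ∑ j, D i j = 1) ∧ (∀ j, ∑ i, D i j = 1)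

/-- The diagonal of a positive, unital, trace-preserving linear map applied to diagonal matrices
is a doubly stochastic transformation. -/
theorem exists_isDoublyStochastic_diag {n : ℕ}
    (Φ : Matrix (Fin n) (Fin n) ℝ →ₗ[ℝ] Matrix (Fin n) (Fin n) ℝ)
    (hpos : ∀ Y, Y.PosSemidef → (Φ Y).PosSemidef) (hone : Φ 1 = 1)
    (htrace : ∀ Y, (Φ Y).trace = Y.trace) :
    ∃ D : Matrix (Fin n) (Fin n) ℝ, IsDoublyStochastic D ∧
      ∀ y, (Φ (diagonal y)).diag = D *ᵥ y := by
  have hsum (y : Fin n → ℝ) : diagonal y = ∑ l, y l • single l l (1 : ℝ) := by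
    ext i j
    simp [Matrix.sum_apply, diagonal_apply, single_apply, ite_and]
  have hmul (y : Fin n → ℝ) :
      (Φ (diagonal y)).diag = (of fun k l => Φ (single l l 1) k k) *ᵥ y := by
    ext k
    rw [hsum, map_sum]
    simp only [map_smul, diag_apply, Matrix.sum_apply, Matrix.smul_apply, smul_eq_mul, mulVec,
      dotProduct, of_apply, mul_comm]
  refine ⟨of fun k l => Φ (single l l 1) k k, ⟨fun k l => ?_, fun k => ?_, fun l => ?_⟩, hmul⟩
  · refine (hpos _ ?_).diag_nonneg
    rw [← diagonal_single]
    exact posSemidef_diagonal_iff.2 fun i => by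
      by_cases h : i = l
      · subst h; simp
      · simp [h]
  · have h := congrFun (hmul fun _ => 1) k
    rw [diagonal_one, hone] at h
    simpa [mulVec, dotProduct] using h.symm
  · simpa [Matrix.trace] using htrace (single l l 1)

/-- The matrix with diagonal `1` and off-diagonal entries `2 aᵢ aⱼ / (aᵢ² + aⱼ²)`. -/
noncomputable def geomMeanCorrelation {ι : Type*} [DecidableEq ι] (a : ι → ℝ) : Matrix ι ι ℝ :=
  of fun i j => if i = j then 1 else 2 * a i * a j / (a i ^ 2 + a j ^ 2)

section geomMeanCorrelation

variable {ι : Type*} [DecidableEq ι] (a : ι → ℝ)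

theorem geomMeanCorrelation_apply_self (i : ι) : geomMeanCorrelation a i i = 1 := by
  simp [geomMeanCorrelation]

theorem geomMeanCorrelation_mul (i j : ι) :
    geomMeanCorrelation a i j * (a i ^ 2 + a j ^ 2) = 2 * a i * a j := by
  by_cases h : i = j
  · subst h; simp [geomMeanCorrelation]; ring
  · simp only [geomMeanCorrelation, of_apply, if_neg h]
    by_cases h0 : a i ^ 2 + a j ^ 2 = 0
    · have : a i = 0 := by nlinarith [sq_nonneg (a i), sq_nonneg (a j)]
      simp [this]
    · field_simp

theorem isHermitian_geomMeanCorrelation : (geomMeanCorrelation a).IsHermitian := by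
  ext i j
  simp only [geomMeanCorrelation, conjTranspose_apply, of_apply, star_trivial, eq_comm (a := j),
    add_comm (a j ^ 2), mul_right_comm 2 (a j)]

variable [Fintype ι]

theorem nonneg_of_geomMeanCorrelation_mulVec_eq_smul {μ : ℝ} {v : ι → ℝ} (hv : v ≠ 0)
    (h : geomMeanCorrelation a *ᵥ v = μ • v) : 0 ≤ μ := by
  have hrow (i : ι) : ∑ j, geomMeanCorrelation a i j * v j = μ * v i := congrFun h i
  by_cases hav : ∀ i, a i * v i = 0
  · obtain ⟨i, hi⟩ := Function.ne_iff.1 hv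
    have hai : a i = 0 := (mul_eq_zero.1 (hav i)).resolve_right hi
    have hsum : ∑ j, geomMeanCorrelation a i j * v j = v i := by
      rw [Finset.sum_eq_single i (fun j _ hj => by simp [geomMeanCorrelation, hj.symm, hai])
        (by simp), geomMeanCorrelation_apply_self, one_mul]
    have : μ = 1 := mul_right_cancel₀ hi (by rw [← hrow, hsum, one_mul])
    simp [this]
  · push Not at hav
    obtain ⟨i, hi⟩ := hav
    have hlyap : ∑ i, ∑ j, v i * (geomMeanCorrelation a i j * (a i ^ 2 + a j ^ 2)) * v j =
        2 * (μ * ∑ i, (a i * v i) ^ 2) := by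
      have hleft : ∑ i, ∑ j, a i ^ 2 * v i * (geomMeanCorrelation a i j * v j) =
          μ * ∑ i, (a i * v i) ^ 2 := by
        simp_rw [← Finset.mul_sum, hrow, Finset.mul_sum]
        exact Finset.sum_congr rfl fun i _ => by ring
      have hright : ∑ i, ∑ j, a j ^ 2 * v j * (geomMeanCorrelation a i j * v i) =
          μ * ∑ i, (a i * v i) ^ 2 := by
        rw [Finset.sum_comm, ← hleft]
        refine Finset.sum_congr rfl fun i _ => Finset.sum_congr rfl fun j _ => ?_
        rw [← (isHermitian_geomMeanCorrelation a).apply j i, star_trivial]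
      rw [two_mul]
      nth_rewrite 1 [← hleft]
      rw [← hright, ← Finset.sum_add_distrib]
      refine Finset.sum_congr rfl fun i _ => ?_
      rw [← Finset.sum_add_distrib]
      exact Finset.sum_congr rfl fun j _ => by ring
    have hsq : ∑ i, ∑ j, v i * (geomMeanCorrelation a i j * (a i ^ 2 + a j ^ 2)) * v j =
        2 * (∑ i, a i * v i) ^ 2 := by
      simp_rw [geomMeanCorrelation_mul, sq, Finset.sum_mul_sum, Finset.mul_sum]
      exact Finset.sum_congr rfl fun i _ => Finset.sum_congr rfl fun j _ => by ring
    have hpos : 0 < ∑ i, (a i * v i) ^ 2 :=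
      Finset.sum_pos' (fun _ _ => sq_nonneg _) ⟨i, Finset.mem_univ i, by positivity⟩
    refine nonneg_of_mul_nonneg_left ?_ hpos
    nlinarith [sq_nonneg (∑ i, a i * v i)]

theorem posSemidef_geomMeanCorrelation : (geomMeanCorrelation a).PosSemidef := by
  have hM := isHermitian_geomMeanCorrelation a
  refine hM.posSemidef_iff_eigenvalues_nonneg.2 fun i =>
    nonneg_of_geomMeanCorrelation_mulVec_eq_smul a (v := hM.eigenvectorBasis i) ?_
      (hM.mulVec_eigenvectorBasis i)
  intro h
  exact hM.eigenvectorBasis.orthonormal.ne_zero i (PiLp.ext fun j => congrFun h j)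

theorem geomMeanCorrelation_hadamard_jordan_sq (X : Matrix ι ι ℝ) :
    geomMeanCorrelation a ⊙ ((1 / 2 : ℝ) • (diagonal a ^ 2 * X + X * diagonal a ^ 2)) =
      diagonal a * X * diagonal a := by
  ext i j
  simp only [hadamard_apply, Matrix.smul_apply, Matrix.add_apply, diagonal_pow, diagonal_mul,
    mul_diagonal, smul_eq_mul, Pi.pow_apply]
  linear_combination (1 / 2 * X i j) * geomMeanCorrelation_mul a i j

end geomMeanCorrelation

/-- Hadamard multiplication by a correlation matrix between two orthogonal changes of basis acts
on diagonals as a doubly stochastic transformation. -/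
theorem exists_isDoublyStochastic_hadamard {n : ℕ} {M : Matrix (Fin n) (Fin n) ℝ}
    (hM : M.PosSemidef) (hdiag : ∀ i, M i i = 1) {P R : Matrix (Fin n) (Fin n) ℝ}
    (hP : P ∈ unitaryGroup (Fin n) ℝ) (hR : R ∈ unitaryGroup (Fin n) ℝ) :
    ∃ D : Matrix (Fin n) (Fin n) ℝ, IsDoublyStochastic D ∧
      ∀ y, (P * (M ⊙ (R * diagonal y * star R)) * star P).diag = D *ᵥ y := by
  let Φ : Matrix (Fin n) (Fin n) ℝ →ₗ[ℝ] Matrix (Fin n) (Fin n) ℝ :=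
    { toFun := fun Y => P * (M ⊙ (R * Y * star R)) * star P
      map_add' := fun Y Z => by simp only [mul_add, add_mul, hadamard_add]
      map_smul' := fun c Y => by
        simp only [mul_smul_comm, smul_mul_assoc, hadamard_smul, RingHom.id_apply] }
  refine exists_isDoublyStochastic_diag Φ (fun Y hY => ?_) ?_ fun Y => ?_
  · exact (hM.hadamard (hY.mul_mul_conjTranspose_same R)).mul_mul_conjTranspose_same P
  · have hM1 : M ⊙ (1 : Matrix (Fin n) (Fin n) ℝ) = 1 :=
      hadamard_one_eq_one_iff.2 (funext hdiag)
    simp [Φ, mem_unitaryGroup_iff.1 hP, mem_unitaryGroup_iff.1 hR, hM1]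
  · have htr (Z : Matrix (Fin n) (Fin n) ℝ) : (M ⊙ Z).trace = Z.trace := by
      simp [Matrix.trace, hdiag]
    change (P * (M ⊙ (R * Y * star R)) * star P).trace = _
    rw [trace_mul_cycle, mem_unitaryGroup_iff'.1 hP, one_mul, htr, trace_mul_cycle,
      mem_unitaryGroup_iff'.1 hR, one_mul]

/-- For real symmetric `A, X`, the matrix `A X A` is majorized by
`A²∘X = (A²X + XA²)/2`: there is a doubly stochastic `D` with
`λ(A X A) = D · λ((A²X + XA²)/2)`. -/
theorem quadRep_majorized_by_jordan_sq {n : ℕ}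
    (A X : Matrix (Fin n) (Fin n) ℝ) (hA : A.IsHermitian) (hX : X.IsHermitian)
    (h1 : (A * X * A).IsHermitian)
    (h2 : ((1 / 2 : ℝ) • (A ^ 2 * X + X * A ^ 2)).IsHermitian) :
    ∃ D : Matrix (Fin n) (Fin n) ℝ, IsDoublyStochastic D ∧
      h1.eigenvalues = D.mulVec h2.eigenvalues := by
  have hspec {B : Matrix (Fin n) (Fin n) ℝ} (hB : B.IsHermitian) :
      ∃ Q ∈ unitaryGroup (Fin n) ℝ, B = Q * diagonal hB.eigenvalues * star Q :=
    ⟨hB.eigenvectorUnitary, hB.eigenvectorUnitary.2, by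
      simpa [Unitary.conjStarAlgAut_apply, Function.comp_def] using! hB.spectral_theorem⟩
  obtain ⟨Q, hQ, hA'⟩ := hspec hA
  obtain ⟨V, hV, h1'⟩ := hspec h1
  obtain ⟨U, hU, h2'⟩ := hspec h2
  generalize hA.eigenvalues = a at hA'
  generalize h2.eigenvalues = y at h2' ⊢
  generalize h1.eigenvalues = z at h1' ⊢
  obtain ⟨D, hD, hDy⟩ := exists_isDoublyStochastic_hadamard (posSemidef_geomMeanCorrelation a)
    (geomMeanCorrelation_apply_self a) (mul_mem (Unitary.star_mem hV) hQ)
    (mul_mem (Unitary.star_mem hQ) hU)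
  refine ⟨D, hD, ?_⟩
  have hQQ : star Q * Q = 1 := mem_unitaryGroup_iff'.1 hQ
  have hVV : star V * V = 1 := mem_unitaryGroup_iff'.1 hV
  have hQA : star Q * A = diagonal a * star Q := by
    rw [hA', ← mul_assoc, ← mul_assoc, hQQ, one_mul]
  have hAQ : A * Q = Q * diagonal a := by
    rw [hA', mul_assoc, hQQ, mul_one]
  have hQA2 : star Q * A ^ 2 = diagonal a ^ 2 * star Q := by
    rw [sq, sq, ← mul_assoc, hQA, mul_assoc, hQA, mul_assoc]
  have hA2Q : A ^ 2 * Q = Q * diagonal a ^ 2 := by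
    rw [sq, sq, mul_assoc, hAQ, ← mul_assoc, hAQ, mul_assoc]
  have hJ : star Q * U * diagonal y * star (star Q * U) =
      (1 / 2 : ℝ) • (diagonal a ^ 2 * (star Q * X * Q) + star Q * X * Q * diagonal a ^ 2) :=
    calc
      _ = star Q * ((1 / 2 : ℝ) • (A ^ 2 * X + X * A ^ 2)) * Q := by
        rw [h2']
        simp only [star_mul, star_star, mul_assoc]
      _ = (1 / 2 : ℝ) • (star Q * A ^ 2 * X * Q + star Q * X * (A ^ 2 * Q)) := by
        simp only [Matrix.mul_smul, Matrix.smul_mul, mul_add, add_mul, mul_assoc]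
      _ = _ := by
        rw [hQA2, hA2Q]
        simp only [mul_assoc]
  rw [← hDy, hJ, geomMeanCorrelation_hadamard_jordan_sq]
  have hdiag : star V * Q * (diagonal a * (star Q * X * Q) * diagonal a) * star (star V * Q) =
      diagonal z :=
    calc
      _ = star V * ((Q * diagonal a * star Q) * X * (Q * diagonal a * star Q)) * V := by
        simp only [star_mul, star_star, mul_assoc]
      _ = star V * V * diagonal z * (star V * V) := by
        rw [← hA', h1']
        simp only [mul_assoc]
      _ = diagonal z := by rw [hVV, one_mul, mul_one]
  rw [hdiag, diag_diagonal]
end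

section
/- Let A and X be n×n real symmetric matrices. Then the largest eigenvalue of A X A is at most the largest eigenvalue of (A²X + XA²)/2, and the smallest eigenvalue of A X A is at least the smallest eigenvalue of (A²X + XA²)/2. -/
open Matrix

section

open scoped Pointwise

variable {n : Type*} [Fintype n] [DecidableEq n]

lemma Matrix.IsHermitian.posSemidef_smul_one_sub_iff {H : Matrix n n ℝ} (hH : H.IsHermitian)
    (M : ℝ) : (M • (1 : Matrix n n ℝ) - H).PosSemidef ↔ ∀ i, hH.eigenvalues i ≤ M := by
  have hs : spectrum ℝ (M • (1 : Matrix n n ℝ) - H) = {M} - Set.range hH.eigenvalues := by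
    rw [← hH.spectrum_real_eq_range_eigenvalues, spectrum.singleton_sub_eq,
      Algebra.algebraMap_eq_smul_one]
  rw [posSemidef_iff_isHermitian_and_spectrum_nonneg, hs]
  have hM : (M • (1 : Matrix n n ℝ) - H).IsHermitian :=
    (isHermitian_one.smul (IsSelfAdjoint.all M)).sub hH
  refine ⟨fun h i => ?_, fun h => ⟨hM, ?_⟩⟩
  · exact sub_nonneg.mp (h.2 (Set.sub_mem_sub rfl ⟨i, rfl⟩))
  · rintro _ ⟨_, rfl, _, ⟨i, rfl⟩, rfl⟩
    exact sub_nonneg.mpr (h i)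

lemma Matrix.IsHermitian.posSemidef_sub_smul_one_iff {H : Matrix n n ℝ} (hH : H.IsHermitian)
    (m : ℝ) : (H - m • (1 : Matrix n n ℝ)).PosSemidef ↔ ∀ i, m ≤ hH.eigenvalues i := by
  have hs : spectrum ℝ (H - m • (1 : Matrix n n ℝ)) = Set.range hH.eigenvalues - {m} := by
    rw [← hH.spectrum_real_eq_range_eigenvalues, spectrum.sub_singleton_eq,
      Algebra.algebraMap_eq_smul_one]
  rw [posSemidef_iff_isHermitian_and_spectrum_nonneg, hs]
  have hm : (H - m • (1 : Matrix n n ℝ)).IsHermitian :=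
    hH.sub (isHermitian_one.smul (IsSelfAdjoint.all m))
  refine ⟨fun h i => ?_, fun h => ⟨hm, ?_⟩⟩
  · exact sub_nonneg.mp (h.2 (Set.sub_mem_sub ⟨i, rfl⟩ rfl))
  · rintro _ ⟨_, ⟨i, rfl⟩, _, rfl, rfl⟩
    exact sub_nonneg.mpr (h i)

lemma Matrix.IsHermitian.exists_posSemidef_smul_one_sub {H : Matrix n n ℝ}
    (hH : H.IsHermitian) : ∃ c : ℝ, (c • (1 : Matrix n n ℝ) - H).PosSemidef :=
  ⟨⨆ i, hH.eigenvalues i, (hH.posSemidef_smul_one_sub_iff _).2 fun i =>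
    le_ciSup (Set.finite_range _).bddAbove i⟩

/-- The Lyapunov operator of the square of an invertible symmetric matrix reflects positivity. -/
lemma Matrix.PosSemidef.of_lyapunov {A Z : Matrix n n ℝ} (hA : A.IsHermitian) (hu : IsUnit A)
    (hZ : Z.IsHermitian) (h : (A ^ 2 * Z + Z * A ^ 2).PosSemidef) : Z.PosSemidef := by
  rw [hZ.posSemidef_iff_eigenvalues_nonneg]
  intro i
  set v : n → ℝ := (hZ.eigenvectorBasis i).ofLp
  have hv : Z *ᵥ v = hZ.eigenvalues i • v := hZ.mulVec_eigenvectorBasis i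
  have hv0 : v ≠ 0 := fun h0 => hZ.eigenvectorBasis.orthonormal.ne_zero i <| by
    ext j
    exact congrFun h0 j
  have hAv : A *ᵥ v ≠ 0 := fun h0 => hv0 <|
    (mulVec_injective_iff_isUnit.2 hu) (by rw [h0, mulVec_zero])
  have hAt : Aᵀ = A := by simpa [conjTranspose_eq_transpose_of_trivial] using hA.eq
  have hZt : Zᵀ = Z := by simpa [conjTranspose_eq_transpose_of_trivial] using hZ.eq
  have hsq : v ⬝ᵥ (A ^ 2 *ᵥ v) = (A *ᵥ v) ⬝ᵥ (A *ᵥ v) := by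
    rw [pow_two, ← mulVec_mulVec, dotProduct_mulVec, ← mulVec_transpose, hAt]
  have hpos : 0 < (A *ᵥ v) ⬝ᵥ (A *ᵥ v) := by
    simpa using dotProduct_star_self_pos_iff.2 hAv
  have h' := h.dotProduct_mulVec_nonneg v
  have hq : v ⬝ᵥ ((A ^ 2 * Z + Z * A ^ 2) *ᵥ v)
      = 2 * hZ.eigenvalues i * ((A *ᵥ v) ⬝ᵥ (A *ᵥ v)) := by
    rw [add_mulVec, ← mulVec_mulVec, ← mulVec_mulVec, hv, dotProduct_add, mulVec_smul,
      dotProduct_mulVec v Z, ← mulVec_transpose, hZt, hv, dotProduct_smul, smul_dotProduct, hsq,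
      smul_eq_mul]
    ring
  rw [star_trivial, hq] at h'
  have := (mul_nonneg_iff_of_pos_right hpos).1 h'
  exact (mul_nonneg_iff_of_pos_left two_pos).1 this

lemma posSemidef_smul_one_sub_quadRep_of_isUnit {A X : Matrix n n ℝ} (hA : A.IsHermitian)
    (hu : IsUnit A) (hX : X.IsHermitian) {M : ℝ}
    (h : (M • (1 : Matrix n n ℝ) - (1 / 2 : ℝ) • (A ^ 2 * X + X * A ^ 2)).PosSemidef) :
    (M • (1 : Matrix n n ℝ) - A * X * A).PosSemidef := by
  have hd : IsUnit A.det := (isUnit_iff_isUnit_det A).1 hu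
  have h1 : A * A⁻¹ = 1 := mul_nonsing_inv A hd
  have h2 : A⁻¹ * A = 1 := nonsing_inv_mul A hd
  have hZ : (M • (A⁻¹ ^ 2) - X).IsHermitian :=
    ((hA.inv.pow 2).smul (IsSelfAdjoint.all M)).sub hX
  have h3 : A ^ 2 * A⁻¹ ^ 2 = 1 := by
    rw [pow_two, pow_two, mul_assoc, ← mul_assoc A A⁻¹, h1, one_mul, h1]
  have h4 : A⁻¹ ^ 2 * A ^ 2 = 1 := by
    rw [pow_two, pow_two, mul_assoc, ← mul_assoc A⁻¹ A, h2, one_mul, h2]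
  have hZ' : (M • (A⁻¹ ^ 2) - X).PosSemidef := by
    refine .of_lyapunov hA hu hZ ?_
    convert h.smul (zero_le_two (α := ℝ)) using 1
    rw [mul_sub, sub_mul, mul_smul_comm, smul_mul_assoc, h3, h4]
    module
  convert hZ'.conjTranspose_mul_mul_same A using 1
  rw [hA.eq, mul_sub, sub_mul, mul_smul_comm, smul_mul_assoc, pow_two, ← mul_assoc A, h1,
    one_mul, h2]

lemma posSemidef_smul_one_sub_quadRep {A X : Matrix n n ℝ} (hA : A.IsHermitian)
    (hX : X.IsHermitian) {M : ℝ}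
    (h : (M • (1 : Matrix n n ℝ) - (1 / 2 : ℝ) • (A ^ 2 * X + X * A ^ 2)).PosSemidef) :
    (M • (1 : Matrix n n ℝ) - A * X * A).PosSemidef := by
  have hone (t : ℝ) : (t • (1 : Matrix n n ℝ)).IsHermitian :=
    isHermitian_one.smul (IsSelfAdjoint.all t)
  have hAX : (A * X + X * A).IsHermitian := by
    simp only [IsHermitian, conjTranspose_add, conjTranspose_mul, hA.eq, hX.eq, add_comm]
  obtain ⟨c, hc⟩ := hAX.exists_posSemidef_smul_one_sub
  obtain ⟨d, hd⟩ := hX.exists_posSemidef_smul_one_sub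
  have key : ∀ᶠ ε : ℝ in nhdsWithin 0 (Set.Ioi 0),
      ((M + ε * c + ε ^ 2 * d) • (1 : Matrix n n ℝ)
        - (A + ε • 1) * X * (A + ε • 1)).PosSemidef := by
    have hfin : ({ε : ℝ | -ε ∈ spectrum ℝ A} \ {0}).Finite :=
      ((finite_real_spectrum (A := A)).preimage neg_injective.injOn).subset Set.sdiff_subset
    have hev : ∀ᶠ ε : ℝ in nhdsWithin 0 (Set.Ioi 0),
        ε ∉ ({ε : ℝ | -ε ∈ spectrum ℝ A} \ {0}) :=
      nhdsWithin_le_nhds (hfin.isClosed.isOpen_compl.mem_nhds (by simp))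
    filter_upwards [hev, self_mem_nhdsWithin] with ε hε hpos
    have hpos : 0 < ε := hpos
    have hu : IsUnit (A + ε • (1 : Matrix n n ℝ)) := by
      have : -ε ∉ spectrum ℝ A := fun hm => hε ⟨hm, hpos.ne'⟩
      rw [spectrum.notMem_iff, Algebra.algebraMap_eq_smul_one] at this
      convert this.neg using 1
      module
    refine posSemidef_smul_one_sub_quadRep_of_isUnit (hA.add (hone ε)) hu hX ?_
    convert (h.add (hc.smul hpos.le)).add (hd.smul (sq_nonneg ε)) using 1
    simp only [pow_two, add_mul, mul_add, smul_mul_assoc, mul_smul_comm, one_mul, mul_one]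
    module
  have hherm : (M • (1 : Matrix n n ℝ) - A * X * A).IsHermitian := by
    refine (hone M).sub ?_
    simpa only [hA.eq] using isHermitian_conjTranspose_mul_mul A hX
  refine .of_dotProduct_mulVec_nonneg hherm fun x => ?_
  have hcont : Continuous fun ε : ℝ => star x ⬝ᵥ
      (((M + ε * c + ε ^ 2 * d) • (1 : Matrix n n ℝ)
        - (A + ε • 1) * X * (A + ε • 1)) *ᵥ x) := by
    fun_prop
  have ht := (hcont.tendsto 0).mono_left (nhdsWithin_le_nhds (s := Set.Ioi (0 : ℝ)))
  simp only [zero_mul, add_zero, zero_smul, ne_eq, OfNat.ofNat_ne_zero, not_false_eq_true,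
    zero_pow] at ht
  exact ge_of_tendsto ht (key.mono fun ε hε => hε.dotProduct_mulVec_nonneg x)

end

/-- For real symmetric `A, X`,
`λ_max(A X A) ≤ λ_max((A²X + XA²)/2)` and `λ_min(A X A) ≥ λ_min((A²X + XA²)/2)`. -/
theorem eigenvalues_max_min_quadRep {n : ℕ}
    (A X : Matrix (Fin n) (Fin n) ℝ) (hA : A.IsHermitian) (hX : X.IsHermitian)
    (h1 : (A * X * A).IsHermitian)
    (h2 : ((1 / 2 : ℝ) • (A ^ 2 * X + X * A ^ 2)).IsHermitian) :
    (⨆ i, h1.eigenvalues i) ≤ (⨆ i, h2.eigenvalues i) ∧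
    (⨅ i, h2.eigenvalues i) ≤ (⨅ i, h1.eigenvalues i) := by
  cases isEmpty_or_nonempty (Fin n) with
  | inl _ => simp
  | inr _ =>
    refine ⟨ciSup_le ?_, le_ciInf ?_⟩
    · rw [← h1.posSemidef_smul_one_sub_iff]
      refine posSemidef_smul_one_sub_quadRep hA hX ?_
      rw [h2.posSemidef_smul_one_sub_iff]
      exact le_ciSup (Set.finite_range _).bddAbove
    · rw [← h1.posSemidef_sub_smul_one_iff]
      have h := (h2.posSemidef_sub_smul_one_iff _).2
        (ciInf_le (Set.finite_range _).bddBelow)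
      have h' := posSemidef_smul_one_sub_quadRep (M := -⨅ i, h2.eigenvalues i) hA hX.neg (by
        convert h using 1
        rw [mul_neg, neg_mul]
        module)
      convert h' using 1
      rw [mul_neg, neg_mul]
      module
end

section
/- Let A be an n×n real symmetric positive semidefinite matrix with positive semidefinite square root S (so S is symmetric positive semidefinite and S² = A), let X be an n×n real symmetric matrix, let μ be a real number, and let p ≥ 1 be a real number. Then ‖S X S − μI‖ₚ ≤ ‖(AX + XA)/2 − μI‖ₚ. -/
open Matrix

/-- Positive semidefiniteness of the Cauchy kernel `1 / (s a + s b)`. -/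
theorem cauchyKernel_quadForm_nonneg {ι : Type*} (t : Finset ι) (s z : ι → ℝ)
    (hs : ∀ i ∈ t, 0 < s i) :
    0 ≤ ∑ a ∈ t, ∑ b ∈ t, 1 / (s a + s b) * (z a * z b) := by
  have hint : ∀ a ∈ t, ∀ b ∈ t, MeasureTheory.IntegrableOn
      (fun x : ℝ => Real.exp (-(s a + s b) * x) * (z a * z b)) (Set.Ioi 0) := fun a ha b hb =>
    (integrableOn_exp_mul_Ioi (by have := hs a ha; have := hs b hb; linarith) 0).mul_const _
  have key : ∫ x in Set.Ioi (0 : ℝ), (∑ a ∈ t, Real.exp (-s a * x) * z a) ^ 2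
      = ∑ a ∈ t, ∑ b ∈ t, 1 / (s a + s b) * (z a * z b) := by
    have expand (x : ℝ) : (∑ a ∈ t, Real.exp (-s a * x) * z a) ^ 2
        = ∑ a ∈ t, ∑ b ∈ t, Real.exp (-(s a + s b) * x) * (z a * z b) := by
      rw [sq, Finset.sum_mul_sum]
      refine Finset.sum_congr rfl fun a _ => Finset.sum_congr rfl fun b _ => ?_
      rw [show -(s a + s b) * x = -s a * x + -s b * x by ring, Real.exp_add]
      ring
    simp_rw [expand]
    rw [MeasureTheory.integral_finsetSum _ fun a ha =>
      MeasureTheory.integrable_finsetSum _ fun b hb => hint a ha b hb]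
    refine Finset.sum_congr rfl fun a ha => ?_
    rw [MeasureTheory.integral_finsetSum _ fun b hb => hint a ha b hb]
    refine Finset.sum_congr rfl fun b hb => ?_
    have hab : 0 < s a + s b := add_pos (hs a ha) (hs b hb)
    rw [MeasureTheory.integral_mul_const, integral_exp_mul_Ioi (by linarith) 0, mul_zero,
      Real.exp_zero, neg_div_neg_eq]
  rw [← key]
  exact MeasureTheory.integral_nonneg fun x => sq_nonneg _

/-- The ratio `2 s a s b / (s a ^ 2 + s b ^ 2)` of the geometric mean of the squares to their
arithmetic mean, completed by `1` on the diagonal where `s` vanishes. -/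
noncomputable def meanRatio {ι : Type*} [DecidableEq ι] (s : ι → ℝ) (a b : ι) : ℝ :=
  2 * s a * s b / (s a ^ 2 + s b ^ 2) + if a = b ∧ s a = 0 then 1 else 0

theorem meanRatio_self {ι : Type*} [DecidableEq ι] (s : ι → ℝ) (a : ι) :
    meanRatio s a a = 1 := by
  by_cases h : s a = 0
  · simp [meanRatio, h]
  · simp only [meanRatio, h, and_false, if_false, add_zero]
    field_simp
    norm_num

theorem meanRatio_quadForm_nonneg {ι : Type*} [Fintype ι] [DecidableEq ι] (s z : ι → ℝ) :
    0 ≤ ∑ a, ∑ b, meanRatio s a b * (z a * z b) := by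
  have hdiag : 0 ≤ ∑ a, ∑ b, (if a = b ∧ s a = 0 then (1 : ℝ) else 0) * (z a * z b) := by
    refine Finset.sum_nonneg fun a _ => Finset.sum_nonneg fun b _ => ?_
    split_ifs with h
    · rw [h.1, one_mul]
      exact mul_self_nonneg _
    · simp
  have hcauchy := cauchyKernel_quadForm_nonneg (Finset.univ.filter fun i => s i ≠ 0)
    (fun i => s i ^ 2) (fun i => s i * z i)
    fun i hi => sq_pos_of_ne_zero (Finset.mem_filter.mp hi).2
  have hratio : ∑ a, ∑ b, 2 * s a * s b / (s a ^ 2 + s b ^ 2) * (z a * z b)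
      = 2 * ∑ a with s a ≠ 0, ∑ b with s b ≠ 0,
        1 / (s a ^ 2 + s b ^ 2) * (s a * z a * (s b * z b)) := by
    rw [Finset.mul_sum, Finset.sum_filter]
    refine Finset.sum_congr rfl fun a _ => ?_
    split_ifs with ha
    · rw [Finset.mul_sum, Finset.sum_filter]
      refine Finset.sum_congr rfl fun b _ => ?_
      split_ifs with hb
      · ring
      · simp [not_not.mp hb]
    · simp [not_not.mp ha]
  simp only [meanRatio, add_mul, Finset.sum_add_distrib, hratio]
  linarith

/-- Multiplying a geometric mean entry by the ratio, together with the common scalar shift. -/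
theorem meanRatio_mul_sub {ι : Type*} [DecidableEq ι] (s : ι → ℝ) (a b : ι) (x μ : ℝ) :
    meanRatio s a b * (1 / 2 * (s a ^ 2 * x + x * s b ^ 2) - μ * if a = b then 1 else 0)
      = s a * x * s b - μ * if a = b then 1 else 0 := by
  by_cases hab : a = b
  · subst hab
    rw [meanRatio_self]
    ring
  · by_cases h : s a ^ 2 + s b ^ 2 = 0
    · have ha : s a = 0 := by nlinarith [sq_nonneg (s a), sq_nonneg (s b)]
      have hb : s b = 0 := by nlinarith [sq_nonneg (s a), sq_nonneg (s b)]
      simp [meanRatio, hab, ha, hb]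
    · simp only [meanRatio, hab, false_and, if_false]
      field_simp
      ring

/-- Schur multiplication by a positive semidefinite kernel with unit diagonal does not increase
the sum of the `p`-th powers of the absolute eigenvalues. -/
theorem sum_abs_rpow_le_of_schurMul {ι : Type*} [Fintype ι] [DecidableEq ι]
    (K : ι → ι → ℝ) (hK : ∀ z : ι → ℝ, 0 ≤ ∑ a, ∑ b, K a b * (z a * z b))
    (hKd : ∀ a, K a a = 1) (P Q : Matrix ι ι ℝ) (hP : Pᵀ * P = 1) (hP' : P * Pᵀ = 1)
    (hQ : Qᵀ * Q = 1) (hQ' : Q * Qᵀ = 1) (β γ : ι → ℝ)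
    (h : ∀ a b, (P * diagonal β * Pᵀ) a b = K a b * (Q * diagonal γ * Qᵀ) a b)
    {p : ℝ} (hp : 1 ≤ p) :
    ∑ i, |β i| ^ p ≤ ∑ j, |γ j| ^ p := by
  have hcol (R : Matrix ι ι ℝ) (hR : Rᵀ * R = 1) (i : ι) : ∑ a, R a i * R a i = 1 := by
    simpa [mul_apply] using congrFun (congrFun hR i) i
  have hrow (R : Matrix ι ι ℝ) (hR : R * Rᵀ = 1) (a b : ι) :
      ∑ i, R a i * R b i = if a = b then 1 else 0 := by
    simpa [mul_apply, one_apply] using congrFun (congrFun hR a) b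
  set w : ι → ι → ℝ := fun i j => ∑ a, ∑ b, K a b * ((P a i * Q a j) * (P b i * Q b j)) with hw
  have hw0 (i j : ι) : 0 ≤ w i j := hK fun a => P a i * Q a j
  have hw1 (i : ι) : ∑ j, w i j = 1 := by
    calc ∑ j, w i j = ∑ a, ∑ b, K a b * (P a i * P b i) * ∑ j, Q a j * Q b j := by
          simp only [hw, Finset.mul_sum]
          rw [Finset.sum_comm]
          refine Finset.sum_congr rfl fun a _ => ?_
          rw [Finset.sum_comm]
          refine Finset.sum_congr rfl fun b _ => Finset.sum_congr rfl fun j _ => ?_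
          ring
      _ = 1 := by simp [hrow Q hQ', hKd, hcol P hP]
  have hw2 (j : ι) : ∑ i, w i j = 1 := by
    calc ∑ i, w i j = ∑ a, ∑ b, K a b * (Q a j * Q b j) * ∑ i, P a i * P b i := by
          simp only [hw, Finset.mul_sum]
          rw [Finset.sum_comm]
          refine Finset.sum_congr rfl fun a _ => ?_
          rw [Finset.sum_comm]
          refine Finset.sum_congr rfl fun b _ => Finset.sum_congr rfl fun i _ => ?_
          ring
      _ = 1 := by simp [hrow P hP', hKd, hcol Q hQ]
  have hβ (i : ι) : β i = ∑ j, w i j * γ j := by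
    have hdiag : Pᵀ * (P * diagonal β * Pᵀ) * P = diagonal β := by
      calc Pᵀ * (P * diagonal β * Pᵀ) * P = (Pᵀ * P) * diagonal β * (Pᵀ * P) := by
            simp only [Matrix.mul_assoc]
        _ = diagonal β := by rw [hP, Matrix.one_mul, Matrix.mul_one]
    have hentry (a b : ι) : (P * diagonal β * Pᵀ) a b = K a b * ∑ j, Q a j * γ j * Q b j := by
      rw [h, mul_apply]
      simp only [mul_diagonal, transpose_apply]
    calc β i = (Pᵀ * (P * diagonal β * Pᵀ) * P) i i := by rw [hdiag, diagonal_apply_eq]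
      _ = ∑ b, (∑ a, P a i * (K a b * ∑ j, Q a j * γ j * Q b j)) * P b i := by
          rw [mul_apply]
          refine Finset.sum_congr rfl fun b _ => ?_
          rw [mul_apply]
          simp only [hentry, transpose_apply]
      _ = ∑ a, ∑ b, ∑ j, K a b * ((P a i * Q a j) * (P b i * Q b j)) * γ j := by
          simp only [Finset.mul_sum, Finset.sum_mul]
          rw [Finset.sum_comm]
          refine Finset.sum_congr rfl fun a _ => Finset.sum_congr rfl fun b _ =>
            Finset.sum_congr rfl fun j _ => ?_
          ring
      _ = ∑ j, w i j * γ j := by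
          simp only [hw, Finset.sum_mul]
          conv_rhs => rw [Finset.sum_comm]
          refine Finset.sum_congr rfl fun a _ => ?_
          rw [Finset.sum_comm]
  calc ∑ i, |β i| ^ p ≤ ∑ i, ∑ j, w i j * |γ j| ^ p := by
        refine Finset.sum_le_sum fun i _ => ?_
        have habs : |β i| ≤ ∑ j, w i j * |γ j| := by
          rw [hβ i]
          refine (Finset.abs_sum_le_sum_abs _ _).trans_eq (Finset.sum_congr rfl fun j _ => ?_)
          rw [abs_mul, abs_of_nonneg (hw0 i j)]
        exact (Real.rpow_le_rpow (abs_nonneg _) habs (by linarith)).trans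
          (Real.rpow_arith_mean_le_arith_mean_rpow _ _ _ (fun j _ => hw0 i j) (hw1 i)
            (fun j _ => abs_nonneg _) hp)
    _ = ∑ j, |γ j| ^ p := by
        rw [Finset.sum_comm]
        refine Finset.sum_congr rfl fun j _ => ?_
        rw [← Finset.sum_mul, hw2, one_mul]

/-- Orthogonal diagonalization of a real symmetric matrix, with plain transposes. -/
theorem Matrix.IsHermitian.exists_orthogonal_diagonalization_s14 {ι : Type*} [Fintype ι]
    [DecidableEq ι] {H : Matrix ι ι ℝ} (hH : H.IsHermitian) :
    ∃ U : Matrix ι ι ℝ, Uᵀ * U = 1 ∧ U * Uᵀ = 1 ∧ H = U * diagonal hH.eigenvalues * Uᵀ := by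
  have hstar : star (hH.eigenvectorUnitary : Matrix ι ι ℝ)
      = (hH.eigenvectorUnitary : Matrix ι ι ℝ)ᵀ := by
    rw [star_eq_conjTranspose, conjTranspose_eq_transpose_of_trivial]
  refine ⟨hH.eigenvectorUnitary, ?_, ?_, ?_⟩
  · rw [← hstar]
    exact Unitary.coe_star_mul_self _
  · rw [← hstar]
    exact Unitary.coe_mul_star_self _
  · rw [← hstar]
    exact hH.spectral_theorem

/-- If `A` is real symmetric positive semidefinite with positive semidefinite
square root `S` (`S² = A`), `X` is real symmetric, `μ ∈ ℝ`, and `p ≥ 1`, then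
`‖S X S − μI‖ₚ ≤ ‖(AX + XA)/2 − μI‖ₚ`. -/
theorem spectralPNorm_sqrt_quadRep_sub_smul_le {n : ℕ}
    (A S X : Matrix (Fin n) (Fin n) ℝ)
    (hA : A.PosSemidef) (hS : S.PosSemidef) (hSA : S * S = A)
    (hX : X.IsHermitian) (μ : ℝ) (p : ℝ) (hp : 1 ≤ p)
    (h1 : (S * X * S - μ • (1 : Matrix (Fin n) (Fin n) ℝ)).IsHermitian)
    (h2 : ((1 / 2 : ℝ) • (A * X + X * A) - μ • (1 : Matrix (Fin n) (Fin n) ℝ)).IsHermitian) :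
    spectralPNorm p h1 ≤ spectralPNorm p h2 := by
  obtain ⟨U, hU, hU', hSU⟩ := hS.isHermitian.exists_orthogonal_diagonalization_s14
  obtain ⟨V, hV, -, hV1⟩ := h1.exists_orthogonal_diagonalization_s14
  obtain ⟨W, hW, -, hW2⟩ := h2.exists_orthogonal_diagonalization_s14
  set s := hS.isHermitian.eigenvalues
  have hUS : Uᵀ * S = diagonal s * Uᵀ := by
    rw [hSU, ← Matrix.mul_assoc, ← Matrix.mul_assoc, hU, Matrix.one_mul]
  have hSU' : S * U = U * diagonal s := by
    rw [hSU, Matrix.mul_assoc, hU, Matrix.mul_one]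
  have horth (R : Matrix (Fin n) (Fin n) ℝ) (hR : Rᵀ * R = 1) :
      (Uᵀ * R)ᵀ * (Uᵀ * R) = 1 := by
    rw [transpose_mul, transpose_transpose, Matrix.mul_assoc, ← Matrix.mul_assoc U, hU',
      Matrix.one_mul, hR]
  have hconj (R D : Matrix (Fin n) (Fin n) ℝ) :
      Uᵀ * R * D * (Uᵀ * R)ᵀ = Uᵀ * (R * D * Rᵀ) * U := by
    simp only [transpose_mul, transpose_transpose, Matrix.mul_assoc]
  have hquad : Uᵀ * (S * X * S - μ • (1 : Matrix (Fin n) (Fin n) ℝ)) * U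
      = diagonal s * (Uᵀ * X * U) * diagonal s - μ • 1 := by
    have hSXS : Uᵀ * (S * X * S) * U = (Uᵀ * S) * X * (S * U) := by
      simp only [Matrix.mul_assoc]
    rw [Matrix.mul_sub, Matrix.sub_mul, hSXS, hUS, hSU', Matrix.mul_smul, Matrix.mul_one,
      Matrix.smul_mul, hU]
    simp only [Matrix.mul_assoc]
  have hUA : Uᵀ * A = diagonal (fun i => s i ^ 2) * Uᵀ := by
    rw [← hSA, ← Matrix.mul_assoc, hUS, Matrix.mul_assoc, hUS, ← Matrix.mul_assoc,
      diagonal_mul_diagonal]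
    simp only [sq]
  have hAU : A * U = U * diagonal (fun i => s i ^ 2) := by
    rw [← hSA, Matrix.mul_assoc, hSU', ← Matrix.mul_assoc, hSU', Matrix.mul_assoc,
      diagonal_mul_diagonal]
    simp only [sq]
  have hjordan :
      Uᵀ * ((1 / 2 : ℝ) • (A * X + X * A) - μ • (1 : Matrix (Fin n) (Fin n) ℝ)) * U
      = (1 / 2 : ℝ) • (diagonal (fun i => s i ^ 2) * (Uᵀ * X * U)
        + (Uᵀ * X * U) * diagonal (fun i => s i ^ 2)) - μ • 1 := by
    have hAX : Uᵀ * (A * X + X * A) * U = (Uᵀ * A) * X * U + Uᵀ * X * (A * U) := by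
      simp only [Matrix.mul_assoc, Matrix.mul_add, Matrix.add_mul]
    rw [Matrix.mul_sub, Matrix.sub_mul, Matrix.mul_smul, Matrix.smul_mul, hAX, hUA, hAU,
      Matrix.mul_smul, Matrix.mul_one, Matrix.smul_mul, hU]
    simp only [Matrix.mul_assoc]
  have hle := sum_abs_rpow_le_of_schurMul (meanRatio s) (meanRatio_quadForm_nonneg s)
    (meanRatio_self s) (Uᵀ * V) (Uᵀ * W) (horth V hV) (mul_eq_one_comm.mp (horth V hV))
    (horth W hW) (mul_eq_one_comm.mp (horth W hW)) h1.eigenvalues h2.eigenvalues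
    (fun a b => by
      rw [hconj, hconj, ← hV1, ← hW2, hquad, hjordan]
      simp only [Matrix.sub_apply, Matrix.smul_apply, Matrix.add_apply, mul_diagonal,
        diagonal_mul, Matrix.one_apply, smul_eq_mul]
      exact (meanRatio_mul_sub s a b _ μ).symm) hp
  exact Real.rpow_le_rpow (Finset.sum_nonneg fun i _ => Real.rpow_nonneg (abs_nonneg _) _) hle
    (by positivity)
end

section
/- Let A and B be n×n real symmetric matrices. Then there exist doubly stochastic n×n matrices S and T such that the eigenvalue vector of A + B equals S applied to the eigenvalue vector of A plus T applied to the eigenvalue vector of B (eigenvalues counted with multiplicity). -/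
open Matrix

/-- The entrywise square of a real orthogonal matrix is doubly stochastic. -/
theorem isDoublyStochastic_sq_of_mem_unitaryGroup {n : ℕ} {W : Matrix (Fin n) (Fin n) ℝ}
    (hW : W ∈ Matrix.unitaryGroup (Fin n) ℝ) :
    IsDoublyStochastic (Matrix.of fun i j => W i j ^ 2) := by
  refine ⟨fun i j => sq_nonneg _, fun i => ?_, fun j => ?_⟩
  · simpa [Matrix.mul_apply, sq] using congrFun (congrFun (Matrix.mem_unitaryGroup_iff.1 hW) i) i
  · simpa [Matrix.mul_apply, sq] using congrFun (congrFun (Matrix.mem_unitaryGroup_iff'.1 hW) j) j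

/-- The diagonal of an orthogonal conjugate of a real symmetric matrix is the image of its
eigenvalue vector under a doubly stochastic matrix. -/
theorem Matrix.IsHermitian.exists_diag_conj_eq_mulVec_eigenvalues {n : ℕ}
    {M : Matrix (Fin n) (Fin n) ℝ} (hM : M.IsHermitian) (U : Matrix.unitaryGroup (Fin n) ℝ) :
    ∃ S : Matrix (Fin n) (Fin n) ℝ, IsDoublyStochastic S ∧
      (star (U : Matrix (Fin n) (Fin n) ℝ) * M * U).diag = S *ᵥ hM.eigenvalues := by
  let W := star U * hM.eigenvectorUnitary
  refine ⟨_, isDoublyStochastic_sq_of_mem_unitaryGroup W.2, ?_⟩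
  have h : star (U : Matrix (Fin n) (Fin n) ℝ) * M * U =
      (W : Matrix (Fin n) (Fin n) ℝ) * diagonal hM.eigenvalues *
        star (W : Matrix (Fin n) (Fin n) ℝ) := by
    conv_lhs => rw [hM.spectral_theorem, Unitary.conjStarAlgAut_apply]
    simp [W, Matrix.mul_assoc]
  ext i
  rw [h, Matrix.diag_apply, Matrix.mul_apply]
  simp only [Matrix.mul_diagonal, Matrix.star_apply, star_trivial, Matrix.mulVec, dotProduct,
    Matrix.of_apply]
  exact Finset.sum_congr rfl fun j _ => by ring

/-- For real symmetric `A, B` there are doubly stochastic matrices `S, T`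
with `λ(A + B) = S λ(A) + T λ(B)` (eigenvalues counted with multiplicity). -/
theorem eigenvalues_add_eq_doublyStochastic_combination {n : ℕ}
    (A B : Matrix (Fin n) (Fin n) ℝ) (hA : A.IsHermitian) (hB : B.IsHermitian)
    (hAB : (A + B).IsHermitian) :
    ∃ S T : Matrix (Fin n) (Fin n) ℝ, IsDoublyStochastic S ∧ IsDoublyStochastic T ∧
      hAB.eigenvalues = S.mulVec hA.eigenvalues + T.mulVec hB.eigenvalues := by
  obtain ⟨S, hS, hSA⟩ := hA.exists_diag_conj_eq_mulVec_eigenvalues hAB.eigenvectorUnitary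
  obtain ⟨T, hT, hTB⟩ := hB.exists_diag_conj_eq_mulVec_eigenvalues hAB.eigenvectorUnitary
  refine ⟨S, T, hS, hT, ?_⟩
  have h := hAB.conjStarAlgAut_star_eigenvectorUnitary
  rw [Unitary.conjStarAlgAut_star_apply] at h
  rw [← hSA, ← hTB, ← Matrix.diag_add, ← Matrix.add_mul, ← Matrix.mul_add, h]
  ext i
  simp
end

section
/- Let T : ℝⁿ → ℝⁿ be a linear map, let r, s, p ∈ [1, ∞) be real numbers and θ ∈ [0,1] with 1/p = (1−θ)/r + θ/s, and let M_r, M_s ≥ 0 be constants such that ‖Tx‖_r ≤ M_r‖x‖_r and ‖Tx‖_s ≤ M_s‖x‖_s for all x ∈ ℝⁿ. Then ‖Tx‖_p ≤ M_r^{1−θ} M_s^{θ} ‖x‖_p for all x ∈ ℝⁿ. -/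
/-- The `ℓ_t`-norm of a vector in `ℝⁿ`: `‖x‖_t = (∑ i, |x i|^t)^(1/t)`. -/
noncomputable def lNorm {n : ℕ} (t : ℝ) (x : Fin n → ℝ) : ℝ :=
  (∑ i, |x i| ^ t) ^ (1 / t)

open Complex in
/-- Averaging `|Re (e^{iφ} z)|^t` over all phases gives a fixed multiple of `‖z‖^t`. -/
lemma integral_abs_re_rotation_rpow (t : ℝ) (z : ℂ) :
    ∫ φ in (0 : ℝ)..2 * Real.pi, |(exp (φ * I) * z).re| ^ t =
      ‖z‖ ^ t * ∫ φ in (0 : ℝ)..2 * Real.pi, |Real.cos φ| ^ t := by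
  have hre (φ : ℝ) : |(exp (φ * I) * z).re| ^ t = ‖z‖ ^ t * |Real.cos (φ + arg z)| ^ t := by
    conv_lhs => rw [← norm_mul_exp_arg_mul_I z]
    rw [mul_left_comm, ← exp_add, ← add_mul, ← ofReal_add, re_ofReal_mul, exp_ofReal_mul_I_re,
      abs_mul, abs_norm, Real.mul_rpow (norm_nonneg z) (abs_nonneg _)]
  have hper : Function.Periodic (fun φ : ℝ => |Real.cos φ| ^ t) (2 * Real.pi) := fun φ => by
    simp only [Real.cos_add_two_pi]
  simp_rw [hre]
  rw [intervalIntegral.integral_const_mul,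
    intervalIntegral.integral_comp_add_right (fun φ => |Real.cos φ| ^ t), zero_add,
    add_comm (2 * Real.pi), hper.intervalIntegral_add_eq (arg z) 0, zero_add]

lemma integral_abs_cos_rpow_pos {t : ℝ} (ht : 0 ≤ t) :
    0 < ∫ φ in (0 : ℝ)..2 * Real.pi, |Real.cos φ| ^ t := by
  refine intervalIntegral.integral_pos (by positivity) ?_ (fun φ _ => by positivity)
    ⟨0, ⟨le_rfl, by positivity⟩, by simp⟩
  exact ((continuous_abs.comp Real.continuous_cos).rpow_const fun _ => Or.inr ht).continuousOn

open Complex in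
/-- A bound on `∑ |A x|^t` over real vectors persists, with the same constant, over complex
vectors. -/
lemma sum_norm_complexification_rpow_le {m n : Type*} [Fintype m] [Fintype n] (A : Matrix m n ℝ)
    {t K : ℝ} (ht : 0 ≤ t) (h : ∀ x : n → ℝ, ∑ i, |∑ j, A i j * x j| ^ t ≤ K * ∑ j, |x j| ^ t)
    (z : n → ℂ) : ∑ i, ‖∑ j, (A i j : ℂ) * z j‖ ^ t ≤ K * ∑ j, ‖z j‖ ^ t := by
  have hcont (w : ℂ) : Continuous fun φ : ℝ => |(exp (φ * I) * w).re| ^ t := by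
    refine Continuous.rpow_const ?_ fun _ => Or.inr ht
    fun_prop
  have hpoint (φ : ℝ) : ∑ i, |(exp (φ * I) * ∑ j, (A i j : ℂ) * z j).re| ^ t ≤
      K * ∑ j, |(exp (φ * I) * z j).re| ^ t := by
    have hre (i : m) : (exp (φ * I) * ∑ j, (A i j : ℂ) * z j).re =
        ∑ j, A i j * (exp (φ * I) * z j).re := by
      rw [Finset.mul_sum, re_sum]
      exact Finset.sum_congr rfl fun j _ => by rw [mul_left_comm, re_ofReal_mul]
    simp_rw [hre]
    exact h _
  have hint := intervalIntegral.integral_mono (μ := MeasureTheory.volume)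
    (a := 0) (b := 2 * Real.pi) (by positivity)
    ((continuous_finsetSum _ fun i _ => hcont _).intervalIntegrable _ _)
    (((continuous_finsetSum _ fun j _ => hcont _).const_mul K).intervalIntegrable _ _) hpoint
  rw [intervalIntegral.integral_const_mul,
    intervalIntegral.integral_finsetSum fun i _ => (hcont _).intervalIntegrable _ _,
    intervalIntegral.integral_finsetSum fun j _ => (hcont _).intervalIntegrable _ _] at hint
  simp_rw [integral_abs_re_rotation_rpow, ← Finset.sum_mul, ← mul_assoc] at hint
  exact le_of_mul_le_mul_right hint (integral_abs_cos_rpow_pos ht)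

/-- Hölder's inequality in a form that includes the exponent `1`. -/
lemma sum_mul_le_rpow_mul_rpow_of_le_rpow {ι : Type*} [Fintype ι] {t : ℝ} (ht : 1 ≤ t)
    {w g h : ι → ℝ} (hw : ∀ i, 0 ≤ w i) (hh : ∀ i, 0 ≤ h i)
    (hgw : ∀ i, g i ≤ w i ^ (1 - 1 / t)) :
    ∑ i, g i * h i ≤ (∑ i, w i) ^ (1 - 1 / t) * (∑ i, h i ^ t) ^ (1 / t) := by
  refine (Finset.sum_le_sum fun i _ => mul_le_mul_of_nonneg_right (hgw i) (hh i)).trans ?_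
  rcases ht.eq_or_lt with rfl | ht
  · simp
  · have hpq : (Real.conjExponent t).HolderConjugate t := (Real.HolderConjugate.conjExponent ht).symm
    have hexp : 1 - 1 / t = 1 / Real.conjExponent t := by
      have := hpq.inv_add_inv_eq_one
      rw [one_div, one_div]; linarith
    have hpow (i : ι) : (w i ^ (1 - 1 / t)) ^ Real.conjExponent t = w i := by
      rw [hexp, one_div, Real.rpow_inv_rpow (hw i) hpq.ne_zero]
    have := Real.inner_le_Lp_mul_Lq_of_nonneg Finset.univ hpq
      (fun i _ => Real.rpow_nonneg (hw i) (1 - 1 / t)) (fun i _ => hh i)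
    simpa only [hpow, ← hexp] using this

/-- The signed complex power `sign a * |a|^u`, which vanishes for `a = 0`. -/
noncomputable def signedCpow (a : ℝ) (u : ℂ) : ℂ :=
  (SignType.sign a : ℝ) * Complex.exp (Real.log |a| * u)

lemma signedCpow_zero_left (u : ℂ) : signedCpow 0 u = 0 := by simp [signedCpow]

lemma norm_signedCpow {a : ℝ} (ha : a ≠ 0) (u : ℂ) : ‖signedCpow a u‖ = |a| ^ u.re := by
  have hsign : |((SignType.sign a : SignType) : ℝ)| = 1 := by
    rcases ha.lt_or_gt with h | h <;> simp [h]
  rw [signedCpow, norm_mul, Complex.norm_real, Real.norm_eq_abs, hsign, one_mul, Complex.norm_exp,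
    Complex.re_ofReal_mul, Real.rpow_def_of_pos (abs_pos.mpr ha)]

lemma norm_signedCpow_le (a : ℝ) (u : ℂ) : ‖signedCpow a u‖ ≤ |a| ^ u.re := by
  rcases eq_or_ne a 0 with rfl | ha
  · rw [signedCpow_zero_left, norm_zero]
    positivity
  · exact (norm_signedCpow ha u).le

lemma norm_signedCpow_rpow (a : ℝ) {t : ℝ} (ht : t ≠ 0) {u : ℂ} (hu : u.re ≠ 0) :
    ‖signedCpow a u‖ ^ t = |a| ^ (u.re * t) := by
  rcases eq_or_ne a 0 with rfl | ha
  · simp [signedCpow_zero_left, Real.zero_rpow ht, Real.zero_rpow (mul_ne_zero hu ht)]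
  · rw [norm_signedCpow ha, ← Real.rpow_mul (abs_nonneg a)]

lemma norm_signedCpow_le_exp (a : ℝ) {u : ℂ} {c : ℝ} (hu : |u.re| ≤ c) :
    ‖signedCpow a u‖ ≤ Real.exp (|Real.log (|a|)| * c) := by
  rcases eq_or_ne a 0 with rfl | ha
  · rw [signedCpow_zero_left, norm_zero]
    positivity
  · rw [norm_signedCpow ha, Real.rpow_def_of_pos (abs_pos.mpr ha), Real.exp_le_exp]
    refine (le_abs_self _).trans ?_
    rw [abs_mul]
    gcongr

lemma signedCpow_ofReal (a b : ℝ) :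
    signedCpow a b = ((SignType.sign a : ℝ) * |a| ^ b : ℝ) := by
  rcases eq_or_ne a 0 with rfl | ha
  · simp [signedCpow_zero_left]
  · rw [signedCpow, Real.rpow_def_of_pos (abs_pos.mpr ha)]
    push_cast
    rfl

lemma signedCpow_one (a : ℝ) : signedCpow a 1 = a := by
  rw [← Complex.ofReal_one, signedCpow_ofReal, Real.rpow_one, sign_mul_abs]

lemma signedCpow_sub_one_mul_self (a : ℝ) {p : ℝ} (hp : p ≠ 0) :
    signedCpow a ((p - 1 : ℝ) : ℂ) * a = (|a| ^ p : ℝ) := by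
  rw [signedCpow_ofReal, ← Complex.ofReal_mul, mul_right_comm, sign_mul_self]
  rcases eq_or_ne a 0 with rfl | ha
  · simp [Real.zero_rpow hp]
  · rw [Real.rpow_sub_one (abs_ne_zero.mpr ha), mul_div_cancel₀ _ (abs_ne_zero.mpr ha)]

lemma Differentiable.signedCpow (a : ℝ) {u : ℂ → ℂ} (hu : Differentiable ℂ u) :
    Differentiable ℂ fun z => signedCpow a (u z) := by
  unfold _root_.signedCpow
  fun_prop

/-- The pairing of `signedCpow`-deformations of `y` and `A x` along the line where the exponents
have real parts `p * (1 - 1/t)` and `p * (1/t)`. -/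
lemma norm_sum_signedCpow_le {m n : Type*} [Fintype m] [Fintype n] (A : Matrix m n ℝ)
    {t p M : ℝ} (ht : 1 ≤ t) (hp : 0 < p) (hM : 0 ≤ M)
    (h : ∀ x : n → ℝ, ∑ i, |∑ j, A i j * x j| ^ t ≤ M ^ t * ∑ j, |x j| ^ t)
    (x : n → ℝ) (y : m → ℝ) {α : ℂ} (hα : α.re = 1 / t) :
    ‖∑ i, signedCpow (y i) (p * (1 - α)) * ∑ j, (A i j : ℂ) * signedCpow (x j) (p * α)‖ ≤
      (∑ i, |y i| ^ p) ^ (1 - 1 / t) * (M * (∑ j, |x j| ^ p) ^ (1 / t)) := by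
  have ht0 : 0 < t := by linarith
  refine (norm_sum_le _ _).trans ?_
  simp_rw [norm_mul]
  refine (sum_mul_le_rpow_mul_rpow_of_le_rpow ht (w := fun i => |y i| ^ p)
    (fun i => by positivity) (fun i => norm_nonneg _) fun i => ?_).trans ?_
  · refine (norm_signedCpow_le _ _).trans_eq ?_
    rw [← Real.rpow_mul (abs_nonneg _), Complex.re_ofReal_mul, Complex.sub_re, Complex.one_re, hα]
  · refine mul_le_mul_of_nonneg_left ?_ (by positivity)
    have hre : ((p : ℂ) * α).re = p * (1 / t) := by rw [Complex.re_ofReal_mul, hα]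
    have hx (j : n) : ‖signedCpow (x j) (p * α)‖ ^ t = |x j| ^ p := by
      rw [norm_signedCpow_rpow _ ht0.ne' (by rw [hre]; positivity), hre]
      congr 1
      field_simp
    have hb := sum_norm_complexification_rpow_le A ht0.le h fun j => signedCpow (x j) (p * α)
    simp_rw [hx] at hb
    refine (Real.rpow_le_rpow (by positivity) hb (by positivity)).trans_eq ?_
    rw [Real.mul_rpow (by positivity) (by positivity), one_div, Real.rpow_rpow_inv hM ht0.ne']

open Complex HadamardThreeLines in
/-- The three lines theorem applied to a matrix bounded on two `ℓ_t`-spaces. -/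
lemma sum_abs_mulVec_rpow_le {m n : Type*} [Fintype m] [Fintype n] (A : Matrix m n ℝ)
    {r s p θ Mr Ms : ℝ} (hr : 1 ≤ r) (hs : 1 ≤ s) (hp : 1 ≤ p)
    (hθ0 : 0 ≤ θ) (hθ1 : θ ≤ 1) (hrsp : 1 / p = (1 - θ) / r + θ / s)
    (hMr : 0 ≤ Mr) (hMs : 0 ≤ Ms)
    (hAr : ∀ x : n → ℝ, ∑ i, |∑ j, A i j * x j| ^ r ≤ Mr ^ r * ∑ j, |x j| ^ r)
    (hAs : ∀ x : n → ℝ, ∑ i, |∑ j, A i j * x j| ^ s ≤ Ms ^ s * ∑ j, |x j| ^ s) (x : n → ℝ) :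
    ∑ i, |∑ j, A i j * x j| ^ p ≤
      ((∑ i, |∑ j, A i j * x j| ^ p) ^ (1 - 1 / r) *
        (Mr * (∑ j, |x j| ^ p) ^ (1 / r))) ^ (1 - θ) *
      ((∑ i, |∑ j, A i j * x j| ^ p) ^ (1 - 1 / s) *
        (Ms * (∑ j, |x j| ^ p) ^ (1 / s))) ^ θ := by
  have hp0 : 0 < p := by linarith
  set y : m → ℝ := fun i => ∑ j, A i j * x j with hy
  change ∑ i, |y i| ^ p ≤ ((∑ i, |y i| ^ p) ^ _ * _) ^ _ * ((∑ i, |y i| ^ p) ^ _ * _) ^ _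
  set α : ℂ → ℂ := fun z => (1 - z) * (1 / r : ℝ) + z * (1 / s : ℝ) with hα
  have hαre (z : ℂ) : (α z).re = (1 - z.re) * (1 / r) + z.re * (1 / s) := by
    simp only [hα, add_re, re_mul_ofReal, sub_re, one_re]
  have hαd : Differentiable ℂ α := by fun_prop
  have hαθ : α θ = (1 / p : ℝ) := by
    rw [hrsp, hα]
    push_cast
    ring
  set F : ℂ → ℂ := fun z => ∑ i, signedCpow (y i) (p * (1 - α z)) *
    ∑ j, (A i j : ℂ) * signedCpow (x j) (p * α z) with hF
  have hFd : Differentiable ℂ F := by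
    refine Differentiable.fun_sum fun i _ => .mul (.signedCpow _ (by fun_prop)) ?_
    exact Differentiable.fun_sum fun j _ => .const_mul (.signedCpow _ (by fun_prop)) _
  have hFθ : F θ = (∑ i, |y i| ^ p : ℝ) := by
    have h1 : (p : ℂ) * α θ = 1 := by
      rw [hαθ, ← ofReal_mul, mul_one_div_cancel hp0.ne', ofReal_one]
    have h2 : (p : ℂ) * (1 - α θ) = (p - 1 : ℝ) := by
      rw [mul_sub, h1]
      push_cast
      ring
    simp only [hF, h1, h2, signedCpow_one]
    push_cast
    refine Finset.sum_congr rfl fun i _ => ?_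
    have := signedCpow_sub_one_mul_self (y i) hp0.ne'
    rw [hy] at this ⊢
    push_cast at this ⊢
    exact this
  have hFb : BddAbove ((norm ∘ F) '' verticalClosedStrip 0 1) := by
    refine ⟨∑ i, Real.exp (|Real.log (|y i|)| * p) *
      ∑ j, ‖(A i j : ℂ)‖ * Real.exp (|Real.log (|x j|)| * p), ?_⟩
    rintro _ ⟨z, ⟨hz0, hz1⟩, rfl⟩
    have hr1 : 1 / r ≤ 1 := by rw [one_div]; exact inv_le_one_of_one_le₀ hr
    have hs1 : 1 / s ≤ 1 := by rw [one_div]; exact inv_le_one_of_one_le₀ hs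
    have hr0 : 0 ≤ 1 / r := by positivity
    have hs0 : 0 ≤ 1 / s := by positivity
    have hα0 : 0 ≤ (α z).re := by rw [hαre]; nlinarith
    have hα1 : (α z).re ≤ 1 := by rw [hαre]; nlinarith
    have hx : |((p : ℂ) * α z).re| ≤ p := by
      rw [re_ofReal_mul, abs_of_nonneg (by positivity)]
      nlinarith
    have hy : |((p : ℂ) * (1 - α z)).re| ≤ p := by
      rw [re_ofReal_mul, sub_re, one_re, abs_of_nonneg (mul_nonneg hp0.le (by linarith))]
      nlinarith
    refine (norm_sum_le _ _).trans (Finset.sum_le_sum fun i _ => ?_)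
    rw [norm_mul]
    refine mul_le_mul (norm_signedCpow_le_exp _ hy) ?_ (norm_nonneg _) (by positivity)
    refine (norm_sum_le _ _).trans (Finset.sum_le_sum fun j _ => ?_)
    rw [norm_mul]
    exact mul_le_mul_of_nonneg_left (norm_signedCpow_le_exp _ hx) (norm_nonneg _)
  have key := norm_le_interp_of_mem_verticalClosedStrip₀₁' F (z := θ)
    ⟨by simpa using hθ0, by simpa using hθ1⟩ hFd.diffContOnCl hFb
    (fun z hz => norm_sum_signedCpow_le A hr hp0 hMr hAr x y (α := α z) <| by
      rw [hαre, show z.re = 0 from hz]; ring)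
    (fun z hz => norm_sum_signedCpow_le A hs hp0 hMs hAs x y (α := α z) <| by
      rw [hαre, show z.re = 1 from hz]; ring)
  rwa [hFθ, norm_real, Real.norm_of_nonneg (by positivity), ofReal_re] at key

lemma lNorm_nonneg {n : ℕ} (t : ℝ) (x : Fin n → ℝ) : 0 ≤ lNorm t x := by
  unfold lNorm
  positivity

lemma lNorm_rpow {n : ℕ} {t : ℝ} (ht : t ≠ 0) (x : Fin n → ℝ) :
    lNorm t x ^ t = ∑ i, |x i| ^ t := by
  rw [lNorm, one_div, Real.rpow_inv_rpow (by positivity) ht]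

/-- interpolation: If `T : ℝⁿ → ℝⁿ` is linear, `r, s, p ∈ [1, ∞)`,
`θ ∈ [0, 1]` with `1/p = (1 − θ)/r + θ/s`, and `‖Tx‖_r ≤ M_r ‖x‖_r`,
`‖Tx‖_s ≤ M_s ‖x‖_s` for all `x`, then `‖Tx‖_p ≤ M_r^(1−θ) M_s^θ ‖x‖_p` for all `x`. -/
theorem lNorm_interpolation {n : ℕ} (T : (Fin n → ℝ) →ₗ[ℝ] (Fin n → ℝ))
    (r s p θ Mr Ms : ℝ) (hr : 1 ≤ r) (hs : 1 ≤ s) (hp : 1 ≤ p)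
    (hθ0 : 0 ≤ θ) (hθ1 : θ ≤ 1) (hrsp : 1 / p = (1 - θ) / r + θ / s)
    (hMr : 0 ≤ Mr) (hMs : 0 ≤ Ms)
    (hTr : ∀ x : Fin n → ℝ, lNorm r (T x) ≤ Mr * lNorm r x)
    (hTs : ∀ x : Fin n → ℝ, lNorm s (T x) ≤ Ms * lNorm s x) :
    ∀ x : Fin n → ℝ, lNorm p (T x) ≤ Mr ^ (1 - θ) * Ms ^ θ * lNorm p x := by
  intro x
  have hT (x : Fin n → ℝ) (i : Fin n) : ∑ j, LinearMap.toMatrix' T i j * x j = T x i :=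
    congrFun (LinearMap.toMatrix'_mulVec T x) i
  have hpow {t M : ℝ} (ht : 1 ≤ t) (hM : 0 ≤ M)
      (h : ∀ x : Fin n → ℝ, lNorm t (T x) ≤ M * lNorm t x) (x : Fin n → ℝ) :
      ∑ i, |∑ j, LinearMap.toMatrix' T i j * x j| ^ t ≤ M ^ t * ∑ j, |x j| ^ t := by
    have ht0 : t ≠ 0 := by linarith
    simp_rw [hT]
    rw [← lNorm_rpow ht0, ← lNorm_rpow ht0, ← Real.mul_rpow hM (lNorm_nonneg t x)]
    exact Real.rpow_le_rpow (lNorm_nonneg _ _) (h x) (by linarith)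
  have key := sum_abs_mulVec_rpow_le (LinearMap.toMatrix' T) hr hs hp hθ0 hθ1 hrsp hMr hMs
    (hpow hr hMr hTr) (hpow hs hMs hTs) x
  simp_rw [hT] at key
  unfold lNorm
  set B := ∑ i, |T x i| ^ p
  set A := ∑ i, |x i| ^ p
  have hA : 0 ≤ A := by positivity
  have hB : 0 ≤ B := by positivity
  rcases hB.eq_or_lt with hB0 | hBpos
  · rw [← hB0, Real.zero_rpow (by positivity)]
    positivity
  have hAexp : (A ^ (1 / r)) ^ (1 - θ) * (A ^ (1 / s)) ^ θ = A ^ (1 / p) := by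
    have hθ1' : 0 ≤ 1 - θ := by linarith
    rw [← Real.rpow_mul hA, ← Real.rpow_mul hA,
      ← Real.rpow_add_of_nonneg hA (by positivity) (by positivity), hrsp]
    congr 1
    ring
  have hBexp : (B ^ (1 - 1 / r)) ^ (1 - θ) * (B ^ (1 - 1 / s)) ^ θ = B ^ (1 - 1 / p) := by
    rw [← Real.rpow_mul hB, ← Real.rpow_mul hB, ← Real.rpow_add hBpos, hrsp]
    congr 1
    ring
  have hBsplit : B = B ^ (1 - 1 / p) * B ^ (1 / p) := by
    rw [← Real.rpow_add hBpos, sub_add_cancel, Real.rpow_one]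
  refine le_of_mul_le_mul_left (a := B ^ (1 - 1 / p)) ?_ (by positivity)
  rw [← hBsplit]
  refine key.trans_eq ?_
  rw [Real.mul_rpow (by positivity) (by positivity), Real.mul_rpow hMr (by positivity),
    Real.mul_rpow (by positivity) (by positivity), Real.mul_rpow hMs (by positivity),
    ← hAexp, ← hBexp]
  ring
end

section
/- Let n ≥ 1 and let a₁, …, aₙ be nonzero real numbers. Then the n×n real symmetric matrix M with entries M_{ij} = 2aᵢaⱼ/(aᵢ² + aⱼ²) is positive semidefinite. -/
open Matrix

theorem sum_sum_mul_mul_div_add_eq_integral {ι : Type*} [Fintype ι] (c b : ι → ℝ)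
    (hb : ∀ i, 0 < b i) :
    ∑ i, ∑ j, c i * c j / (b i + b j) =
      ∫ t in Set.Iic (0 : ℝ), (∑ i, c i * Real.exp (b i * t)) ^ 2 := by
  have hint (i j : ι) : MeasureTheory.IntegrableOn
      (fun t => c i * c j * Real.exp ((b i + b j) * t)) (Set.Iic (0 : ℝ)) :=
    (integrableOn_exp_mul_Iic (add_pos (hb i) (hb j)) 0).const_mul _
  have hsq (t : ℝ) : (∑ i, c i * Real.exp (b i * t)) ^ 2 =
      ∑ i, ∑ j, c i * c j * Real.exp ((b i + b j) * t) := by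
    rw [sq, Finset.sum_mul_sum]
    refine Finset.sum_congr rfl fun i _ => Finset.sum_congr rfl fun j _ => ?_
    rw [add_mul, Real.exp_add]
    ring
  simp_rw [hsq]
  rw [MeasureTheory.integral_finsetSum _
    fun i _ => MeasureTheory.integrable_finsetSum _ fun j _ => hint i j]
  refine Finset.sum_congr rfl fun i _ => ?_
  rw [MeasureTheory.integral_finsetSum _ fun j _ => hint i j]
  refine Finset.sum_congr rfl fun j _ => ?_
  rw [MeasureTheory.integral_const_mul, integral_exp_mul_Iic (add_pos (hb i) (hb j)),
    mul_zero, Real.exp_zero, mul_one_div]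

/-- For `n ≥ 1` and nonzero reals `a₁, …, aₙ`, the symmetric matrix
`M` with `M i j = 2 aᵢ aⱼ / (aᵢ² + aⱼ²)` is positive semidefinite. -/
theorem posSemidef_two_mul_div_sq_add_sq {n : ℕ} (hn : 1 ≤ n)
    (a : Fin n → ℝ) (ha : ∀ i, a i ≠ 0) :
    (Matrix.of fun i j => 2 * a i * a j / (a i ^ 2 + a j ^ 2) :
      Matrix (Fin n) (Fin n) ℝ).PosSemidef := by
  refine .of_dotProduct_mulVec_nonneg (Matrix.IsHermitian.ext fun i j => ?_) fun x => ?_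
  · simp only [Matrix.of_apply, star_trivial]
    ring
  · have hform : star x ⬝ᵥ ((Matrix.of fun i j => 2 * a i * a j / (a i ^ 2 + a j ^ 2) :
        Matrix (Fin n) (Fin n) ℝ) *ᵥ x) =
        2 * ∑ i, ∑ j, x i * a i * (x j * a j) / (a i ^ 2 + a j ^ 2) := by
      simp only [dotProduct, mulVec, Finset.mul_sum, Matrix.of_apply, star_trivial]
      refine Finset.sum_congr rfl fun i _ => Finset.sum_congr rfl fun j _ => ?_
      ring
    rw [hform, sum_sum_mul_mul_div_add_eq_integral (fun i => x i * a i) (fun i => a i ^ 2)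
      fun i => sq_pos_of_ne_zero (ha i)]
    exact mul_nonneg zero_le_two (MeasureTheory.integral_nonneg fun t => sq_nonneg _)
end
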